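/- arXiv:1901.03948 — 6 statements merged into one kernel-verified Lean document; each statement's English description precedes it below -/
import Mathlib

section
/- Let D be a finite directed acyclic graph (DAG). For disjoint vertex subsets A, B, S, say A ⊥_D B | S (d-separation) if every path from A to B is blocked by S. Then the independence model ⊥_D satisfies the graphoid axioms: for mutually disjoint subsets A, B, C, D', (S1) symmetry; (S2) decomposition; (S3) weak union; (S4) contraction; (S5) intersection. -/
namespace DSepGraphoid

variable {V : Type*}

/-- Adjacency in the underlying undirected graph of the digraph `E`. -/
def Adj (E : V → V → Prop) (a b : V) : Prop := E a b ∨ E b a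

/-- `E` is a DAG (directed acyclic graph): no directed cycles (in particular no self-loops). -/
def Acyclic (E : V → V → Prop) : Prop := ∀ v, ¬ Relation.TransGen E v v

/-- `p` is a path (a walk with no repeated vertices) from `a` to `b` in the underlying
undirected graph of the digraph `E`, recorded as its list of vertices. -/
def IsPathList (E : V → V → Prop) (a b : V) (p : List V) : Prop :=
  p.Chain' (Adj E) ∧ p.head? = some a ∧ p.getLast? = some b ∧ p.Nodup

/-- `w` is a collider on the path `p`: two arrowheads meet at `w`, i.e. the configuration
`x → w ← y` occurs as consecutive vertices of `p`. -/
def IsCollider (E : V → V → Prop) (p : List V) (w : V) : Prop :=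
  ∃ x y, [x, w, y] <:+: p ∧ E x w ∧ E y w

/-- `An S`: the smallest ancestral set containing `S`, i.e. `S` together with all
ancestors of its elements. -/
def An (E : V → V → Prop) (S : Set V) : Set V :=
  {u | ∃ v ∈ S, Relation.ReflTransGen E u v}

/-- The path `p` is connecting relative to `S`: every collider on `p` lies in `An S`
and every non-collider on `p` lies outside `S`. -/
def Connecting (E : V → V → Prop) (S : Set V) (p : List V) : Prop :=
  (∀ w, IsCollider E p w → w ∈ An E S) ∧ (∀ w ∈ p, ¬ IsCollider E p w → w ∉ S)

/-- d-separation: `A ⊥_D B | S` iff every path from `A` to `B` is blocked by `S`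
(i.e. no path from `A` to `B` is connecting relative to `S`). -/
def DSep (E : V → V → Prop) (A B S : Set V) : Prop :=
  ∀ a ∈ A, ∀ b ∈ B, ∀ p : List V, IsPathList E a b p → ¬ Connecting E S p

theorem adj_symm {E : V → V → Prop} {a b : V} (h : Adj E a b) : Adj E b a := Or.symm h

theorem isCollider_iff_getElem? {E : V → V → Prop} {p : List V} {w : V} :
    IsCollider E p w ↔ ∃ i x y, p[i]? = some x ∧ p[i + 1]? = some w ∧ p[i + 2]? = some y ∧
      E x w ∧ E y w := by
  constructor
  · rintro ⟨x, y, ⟨s, t, rfl⟩, hx, hy⟩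
    exact ⟨s.length, x, y, by simp, by simp, by simp, hx, hy⟩
  · rintro ⟨i, x, y, h0, h1, h2, hx, hy⟩
    refine ⟨x, y, ⟨p.take i, p.drop (i + 3), ?_⟩, hx, hy⟩
    obtain ⟨l0, rfl⟩ := List.getElem?_eq_some_iff.1 h0
    obtain ⟨l1, rfl⟩ := List.getElem?_eq_some_iff.1 h1
    obtain ⟨l2, rfl⟩ := List.getElem?_eq_some_iff.1 h2
    conv_rhs => rw [← List.take_append_drop i p, List.drop_eq_getElem_cons l0,
      List.drop_eq_getElem_cons l1, List.drop_eq_getElem_cons l2]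
    simp

theorem IsCollider.mono {E : V → V → Prop} {p q : List V} {w : V} (h : IsCollider E p w)
    (hpq : p <:+: q) : IsCollider E q w := by
  obtain ⟨x, y, hi, hx, hy⟩ := h
  exact ⟨x, y, hi.trans hpq, hx, hy⟩

theorem IsCollider.reverse {E : V → V → Prop} {p : List V} {w : V} (h : IsCollider E p w) :
    IsCollider E p.reverse w := by
  obtain ⟨x, y, hi, hx, hy⟩ := h
  exact ⟨y, x, by simpa using List.reverse_infix.2 hi, hy, hx⟩

theorem isCollider_reverse {E : V → V → Prop} {p : List V} {w : V} :
    IsCollider E p.reverse w ↔ IsCollider E p w :=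
  ⟨fun h => by simpa using h.reverse, IsCollider.reverse⟩

theorem IsCollider.mem {E : V → V → Prop} {p : List V} {w : V} (h : IsCollider E p w) :
    w ∈ p := by
  obtain ⟨x, y, hi, -, -⟩ := h
  exact hi.subset (by simp)

theorem IsPathList.reverse {E : V → V → Prop} {a b : V} {p : List V} (h : IsPathList E a b p) :
    IsPathList E b a p.reverse := by
  obtain ⟨hc, hh, hl, hn⟩ := h
  refine ⟨?_, by simpa using hl, by simpa using hh, List.nodup_reverse.2 hn⟩
  exact List.isChain_reverse.2 (hc.imp fun _ _ => adj_symm)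

theorem connecting_reverse {E : V → V → Prop} {S : Set V} {p : List V} :
    Connecting E S p.reverse ↔ Connecting E S p := by
  simp [Connecting, isCollider_reverse]

theorem DSep.symm {E : V → V → Prop} {A B S : Set V} (h : DSep E A B S) : DSep E B A S :=
  fun b hb a ha p hp hc => h a ha b hb p.reverse hp.reverse (connecting_reverse.2 hc)

theorem IsPathList.take {E : V → V → Prop} {a b w : V} {p : List V} {k : ℕ}
    (h : IsPathList E a b p) (hk : p[k]? = some w) : IsPathList E a w (p.take (k + 1)) := by
  obtain ⟨hc, hh, hl, hn⟩ := h
  refine ⟨hc.take _, by simpa [List.head?_take] using hh, ?_, hn.sublist (List.take_sublist _ _)⟩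
  simp [List.getLast?_take, hk]

theorem IsCollider.of_take {E : V → V → Prop} {p : List V} {k : ℕ} {u : V}
    (h : IsCollider E (p.take (k + 1)) u) :
    IsCollider E p u ∧ ∃ i < k, p[i]? = some u := by
  refine ⟨h.mono (List.take_prefix _ _).isInfix, ?_⟩
  obtain ⟨i, x, y, h0, h1, h2, -, -⟩ := isCollider_iff_getElem?.1 h
  simp only [List.getElem?_take] at h0 h1 h2
  exact ⟨i + 1, by grind, by grind⟩

theorem eq_or_not_isCollider_of_take {E : V → V → Prop} {p : List V} {k : ℕ} {u w : V}
    (hn : p.Nodup) (hk : p[k]? = some w) (hu : u ∈ p.take (k + 1))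
    (h : ¬ IsCollider E (p.take (k + 1)) u) :
    u = w ∨ ¬ IsCollider E p u ∧ ∃ i < k, p[i]? = some u := by
  obtain ⟨j, hj⟩ := List.mem_iff_getElem?.1 hu
  rw [List.getElem?_take] at hj
  have hjk : j < k + 1 := by grind
  rw [if_pos hjk] at hj
  rcases Nat.lt_succ_iff_lt_or_eq.1 hjk with hlt | rfl
  · refine Or.inr ⟨fun hc => h ?_, j, hlt, hj⟩
    obtain ⟨i, x, y, h0, h1, h2, hx, hy⟩ := isCollider_iff_getElem?.1 hc
    have hij : i + 1 = j :=
      (List.getElem?_inj (List.getElem?_eq_some_iff.1 h1).1 hn).1 (h1.trans hj.symm)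
    refine isCollider_iff_getElem?.2 ⟨i, x, y, ?_, ?_, ?_, hx, hy⟩ <;>
      rw [List.getElem?_take, if_pos (by omega)] <;> assumption
  · left; simpa [hj] using hk

theorem Connecting.take {E : V → V → Prop} {S : Set V} {p : List V} {k : ℕ} {w : V}
    (h : Connecting E S p) (hn : p.Nodup) (hk : p[k]? = some w) (hw : w ∉ S) :
    Connecting E S (p.take (k + 1)) := by
  refine ⟨fun u hu => h.1 u hu.of_take.1, fun u hu hc => ?_⟩
  rcases eq_or_not_isCollider_of_take hn hk hu hc with rfl | ⟨hc', -⟩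
  · exact hw
  · exact h.2 u (List.mem_of_mem_take hu) hc'

theorem subset_An (E : V → V → Prop) (S : Set V) : S ⊆ An E S :=
  fun v hv => ⟨v, hv, .refl⟩

theorem An_mono (E : V → V → Prop) {S T : Set V} (h : S ⊆ T) : An E S ⊆ An E T :=
  fun _ ⟨v, hv, huv⟩ => ⟨v, h hv, huv⟩

/-- A connecting path ending outside `An E S` can be prolonged along an outgoing edge, after
cutting it short if the new endpoint already lies on it. -/
theorem exists_connecting_of_edge {E : V → V → Prop} (hE : Acyclic E) {S : Set V} {a v w : V}
    {p : List V} (hp : IsPathList E a v p) (hc : Connecting E S p) (hvw : E v w)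
    (hw : w ∉ An E S) : ∃ q, IsPathList E a w q ∧ Connecting E S q := by
  have hwS : w ∉ S := fun h => hw (subset_An E S h)
  by_cases hwp : w ∈ p
  · obtain ⟨k, hk⟩ := List.mem_iff_getElem?.1 hwp
    exact ⟨_, hp.take hk, hc.take hp.2.2.2 hk hwS⟩
  obtain ⟨hch, hh, hl, hn⟩ := hp
  refine ⟨p ++ [w], ⟨?_, ?_, by simp, ?_⟩, ?_, ?_⟩
  · refine List.IsChain.append hch (by simp) ?_
    simp only [hl, List.head?_cons, Option.mem_def, Option.some.injEq]
    rintro x rfl y rfl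
    exact Or.inl hvw
  · simp [List.head?_append, hh]
  · rw [List.nodup_append]
    exact ⟨hn, by simp, by simp; rintro x hx rfl; exact hwp hx⟩
  · intro u hu
    obtain ⟨i, x, y, h0, h1, h2, hx, hy⟩ := isCollider_iff_getElem?.1 hu
    by_cases hi : i + 2 < p.length
    · rw [List.getElem?_append_left (by omega)] at h0 h1 h2
      exact hc.1 u (isCollider_iff_getElem?.2 ⟨i, x, y, h0, h1, h2, hx, hy⟩)
    · have hi' : i + 2 = p.length := by
        have := (List.getElem?_eq_some_iff.1 h2).1
        simp at this
        omega
      rw [List.getElem?_append_left (by omega)] at h1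
      rw [List.getLast?_eq_getElem?, ← hi'] at hl
      obtain rfl : u = v := by simpa [h1] using hl
      obtain rfl : w = y := by simpa [hi'] using h2
      exact absurd ((Relation.TransGen.single hvw).tail hy) (hE u)
  · intro u hu hcu
    rcases List.mem_append.1 hu with hu | hu
    · exact hc.2 u hu fun h => hcu (h.mono (List.prefix_append _ _).isInfix)
    · rw [List.mem_singleton.1 hu]
      exact hwS

theorem exists_connecting_of_reflTransGen {E : V → V → Prop} (hE : Acyclic E) {S : Set V}
    {a v d : V} (hvd : Relation.ReflTransGen E v d) (hv : ∀ s ∈ S, ¬ Relation.ReflTransGen E v s)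
    (h : ∃ p, IsPathList E a v p ∧ Connecting E S p) :
    ∃ q, IsPathList E a d q ∧ Connecting E S q := by
  induction hvd with
  | refl => exact h
  | tail hvb hbc ih =>
    obtain ⟨p, hp, hc⟩ := ih
    exact exists_connecting_of_edge hE hp hc hbc
      fun ⟨s, hs, hcs⟩ => hv s hs ((hvb.tail hbc).trans hcs)

theorem DSep.mono_right {E : V → V → Prop} {A B B' S : Set V} (h : DSep E A B S) (hB : B' ⊆ B) :
    DSep E A B' S :=
  fun a ha b hb => h a ha b (hB hb)

theorem DSep.weak_union {E : V → V → Prop} (hE : Acyclic E) {A B C D : Set V}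
    (h : DSep E A (B ∪ D) C) : DSep E A B (C ∪ D) := by
  classical
  intro a ha b hb p hp hc
  by_cases hex : ∃ (k : ℕ) (w : V), p[k]? = some w ∧ IsCollider E p w ∧ w ∉ An E C
  · obtain ⟨w, hk, hwc, hwC⟩ := Nat.find_spec hex
    have hmin := fun j hj => Nat.find_min hex (m := j) hj
    obtain ⟨d, hd | hd, hwd⟩ := hc.1 w hwc
    · exact hwC ⟨d, hd, hwd⟩
    have hcon : Connecting E C (p.take (Nat.find hex + 1)) := by
      refine ⟨fun u hu => ?_, fun u hu hcu huC => ?_⟩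
      · obtain ⟨hu', i, hi, hiu⟩ := hu.of_take
        by_contra huC
        exact hmin i hi ⟨u, hiu, hu', huC⟩
      · rcases eq_or_not_isCollider_of_take hp.2.2.2 hk hu hcu with rfl | ⟨hu', -⟩
        · exact hwC (subset_An E C huC)
        · exact hc.2 u (List.mem_of_mem_take hu) hu' (Or.inl huC)
    obtain ⟨q, hq, hqc⟩ := exists_connecting_of_reflTransGen hE hwd
      (fun s hs hws => hwC ⟨s, hs, hws⟩) ⟨_, hp.take hk, hcon⟩
    exact h a ha d (Or.inr hd) q hq hqc
  · refine h a ha b (Or.inl hb) p hp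
      ⟨fun u hu => ?_, fun u hu hcu huC => hc.2 u hu hcu (Or.inl huC)⟩
    obtain ⟨k, hk⟩ := List.mem_iff_getElem?.1 hu.mem
    by_contra huC
    exact hex ⟨k, u, hk, hu, huC⟩

theorem DSep.contraction {E : V → V → Prop} {A B C D : Set V} (hBC : Disjoint B C)
    (hB : DSep E A B C) (hD : DSep E A D (B ∪ C)) : DSep E A (B ∪ D) C := by
  rintro a ha x (hx | hx) p hp hc
  · exact hB a ha x hx p hp hc
  refine hD a ha x hx p hp ⟨fun u hu => An_mono E Set.subset_union_right (hc.1 u hu), ?_⟩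
  rintro u hu hcu (huB | huC)
  · obtain ⟨k, hk⟩ := List.mem_iff_getElem?.1 hu
    exact hB a ha u huB _ (hp.take hk)
      (hc.take hp.2.2.2 hk (Set.disjoint_left.1 hBC huB))
  · exact hc.2 u hu hcu huC

theorem IsPathList.not_isCollider_getLast {E : V → V → Prop} {a b : V} {p : List V}
    (hp : IsPathList E a b p) : ¬ IsCollider E p b := by
  intro h
  obtain ⟨i, x, y, h0, h1, h2, -, -⟩ := isCollider_iff_getElem?.1 h
  have hl := hp.2.2.1
  rw [List.getLast?_eq_getElem?] at hl
  have := (List.getElem?_inj (List.getElem?_eq_some_iff.1 h1).1 hp.2.2.2).1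
    (h1.trans hl.symm)
  have := (List.getElem?_eq_some_iff.1 h2).1
  omega

theorem DSep.intersection {E : V → V → Prop} {A B C D : Set V} (hBC : Disjoint B C)
    (hBD : Disjoint B D) (hCD : Disjoint C D)
    (hB : DSep E A B (C ∪ D)) (hC : DSep E A C (B ∪ D)) : DSep E A (B ∪ C) D := by
  classical
  intro a ha x hx p hp hc
  have hex : ∃ (k : ℕ) (w : V), p[k]? = some w ∧ w ∈ B ∪ C ∧ ¬ IsCollider E p w :=
    ⟨p.length - 1, x, by rw [← List.getLast?_eq_getElem?]; exact hp.2.2.1, hx,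
      hp.not_isCollider_getLast⟩
  obtain ⟨w, hk, hw, -⟩ := Nat.find_spec hex
  have hmin := fun j hj => Nat.find_min hex (m := j) hj
  have key : ∀ T ⊆ B ∪ C, w ∉ T → w ∉ D →
      Connecting E (T ∪ D) (p.take (Nat.find hex + 1)) := by
    refine fun T hT hwT hwD => ⟨fun u hu => An_mono E Set.subset_union_right
      (hc.1 u hu.of_take.1), fun u hu hcu => ?_⟩
    rcases eq_or_not_isCollider_of_take hp.2.2.2 hk hu hcu with rfl | ⟨hu', i, hi, hiu⟩
    · exact fun h => h.elim hwT hwD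
    · rintro (huT | huD)
      · exact hmin i hi ⟨u, hiu, hT huT, hu'⟩
      · exact hc.2 u (List.mem_of_mem_take hu) hu' huD
  rcases hw with hw | hw
  · exact hB a ha w hw _ (hp.take hk) (key C Set.subset_union_right
      (Set.disjoint_left.1 hBC hw) (Set.disjoint_left.1 hBD hw))
  · exact hC a ha w hw _ (hp.take hk) (key B Set.subset_union_left
      (Set.disjoint_right.1 hBC hw) (Set.disjoint_left.1 hCD hw))

/-- **d-separation in a finite DAG satisfies the graphoid axioms** (S1)–(S5)
for mutually disjoint subsets of the vertex set. -/
theorem dsep_graphoid [Fintype V] (E : V → V → Prop) (hE : Acyclic E) :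
    -- (S1) symmetry
    (∀ A B C : Set V, Disjoint A B → Disjoint A C → Disjoint B C →
      DSep E A B C → DSep E B A C) ∧
    -- (S2) decomposition
    (∀ A B C D : Set V, Disjoint A B → Disjoint A C → Disjoint A D →
      Disjoint B C → Disjoint B D → Disjoint C D →
      DSep E A (B ∪ D) C → DSep E A B C ∧ DSep E A D C) ∧
    -- (S3) weak union
    (∀ A B C D : Set V, Disjoint A B → Disjoint A C → Disjoint A D →
      Disjoint B C → Disjoint B D → Disjoint C D →
      DSep E A (B ∪ D) C → DSep E A B (C ∪ D)) ∧
    -- (S4) contraction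
    (∀ A B C D : Set V, Disjoint A B → Disjoint A C → Disjoint A D →
      Disjoint B C → Disjoint B D → Disjoint C D →
      DSep E A B C → DSep E A D (B ∪ C) → DSep E A (B ∪ D) C) ∧
    -- (S5) intersection
    (∀ A B C D : Set V, Disjoint A B → Disjoint A C → Disjoint A D →
      Disjoint B C → Disjoint B D → Disjoint C D →
      DSep E A B (C ∪ D) → DSep E A C (B ∪ D) → DSep E A (B ∪ C) D) := by
  refine ⟨fun _ _ _ _ _ _ h => h.symm, ?_, ?_, ?_, ?_⟩
  · intro _ _ _ _ _ _ _ _ _ _ h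
    exact ⟨h.mono_right Set.subset_union_left, h.mono_right Set.subset_union_right⟩
  · intro _ _ _ _ _ _ _ _ _ _ h
    exact h.weak_union hE
  · intro _ _ _ _ _ _ _ hBC _ _ hB hD
    exact hB.contraction hBC hD
  · intro _ _ _ _ _ _ _ hBC hBD hCD hB hC
    exact hB.intersection hBC hBD hCD hC

end DSepGraphoid
end

section
/- Let A, B and S be disjoint subsets of the vertex set of a finite directed acyclic graph D. Then A and B are d-separated by S in D if and only if S separates A from B in the moral graph of the subgraph of D induced by the smallest ancestral set containing A ∪ B ∪ S; that is, A ⊥_D B | S holds if and only if every path from A to B in (D restricted to An(A ∪ B ∪ S))^m intersects S. -/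
namespace MoralSep

variable {V : Type*}

/-- Adjacency in the underlying undirected graph of the digraph `E`. -/
def Adj (E : V → V → Prop) (a b : V) : Prop := E a b ∨ E b a

/-- `E` is a DAG: no directed cycles (in particular no self-loops). -/
def Acyclic (E : V → V → Prop) : Prop := ∀ v, ¬ Relation.TransGen E v v

/-- `p` is a path from `a` to `b` in the underlying undirected graph of `E`. -/
def IsPathList (E : V → V → Prop) (a b : V) (p : List V) : Prop :=
  p.Chain' (Adj E) ∧ p.head? = some a ∧ p.getLast? = some b ∧ p.Nodup

/-- `w` is a collider on the path `p`: the configuration `x → w ← y` occurs on `p`. -/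
def IsCollider (E : V → V → Prop) (p : List V) (w : V) : Prop :=
  ∃ x y, [x, w, y] <:+: p ∧ E x w ∧ E y w

/-- The smallest ancestral set containing `S`. -/
def An (E : V → V → Prop) (S : Set V) : Set V :=
  {u | ∃ v ∈ S, Relation.ReflTransGen E u v}

/-- The path `p` is connecting relative to `S`: every collider on `p` is in `An S`,
every non-collider on `p` is outside `S`. -/
def Connecting (E : V → V → Prop) (S : Set V) (p : List V) : Prop :=
  (∀ w, IsCollider E p w → w ∈ An E S) ∧ (∀ w ∈ p, ¬ IsCollider E p w → w ∉ S)

/-- d-separation of `A` from `B` by `S` in the DAG `E`. -/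
def DSep (E : V → V → Prop) (A B S : Set V) : Prop :=
  ∀ a ∈ A, ∀ b ∈ B, ∀ p : List V, IsPathList E a b p → ¬ Connecting E S p

/-- Adjacency in the moral graph of the subgraph of `E` induced by the vertex set `W`:
`u ∼ v` iff `u, v ∈ W`, `u ≠ v`, and `u`, `v` are joined by an edge of the induced
subgraph or have a common child in it. -/
def MoralAdj (E : V → V → Prop) (W : Set V) (u v : V) : Prop :=
  u ∈ W ∧ v ∈ W ∧ u ≠ v ∧ (E u v ∨ E v u ∨ ∃ c ∈ W, E u c ∧ E v c)

/-- `S` separates `A` from `B` in the moral graph of the subgraph of `E` induced by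
`An (A ∪ B ∪ S)`: every path from `A` to `B` in that undirected graph intersects `S`. -/
def MoralSeparates (E : V → V → Prop) (A B S : Set V) : Prop :=
  ∀ a ∈ A, ∀ b ∈ B, ∀ p : List V,
    p.Chain' (MoralAdj E (An E (A ∪ B ∪ S))) → p.head? = some a → p.getLast? = some b →
      p.Nodup → ∃ s ∈ S, s ∈ p

theorem mem_An_of_reflTransGen {E : V → V → Prop} {S : Set V} {u v : V}
    (huv : Relation.ReflTransGen E u v) (hv : v ∈ An E S) : u ∈ An E S := by
  obtain ⟨s, hs, hvs⟩ := hv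
  exact ⟨s, hs, huv.trans hvs⟩

theorem subset_An (E : V → V → Prop) (S : Set V) : S ⊆ An E S :=
  fun v hv => ⟨v, hv, .refl⟩

theorem An_mono (E : V → V → Prop) {S T : Set V} (h : S ⊆ T) : An E S ⊆ An E T :=
  fun _ ⟨s, hs, hus⟩ => ⟨s, h hs, hus⟩

theorem Acyclic.not_edge {E : V → V → Prop} (hE : Acyclic E) {u v : V} (huv : E u v) :
    ¬ E v u :=
  fun hvu => hE u (.tail (.single huv) hvu)

theorem Acyclic.ne {E : V → V → Prop} (hE : Acyclic E) {u v : V} (huv : E u v) : u ≠ v := by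
  rintro rfl
  exact hE u (.single huv)

/-- Every vertex reachable along a relation is reachable along a chain without repetitions. -/
theorem exists_nodup_chain_of_reflTransGen {r : V → V → Prop} {a b : V}
    (h : Relation.ReflTransGen r a b) :
    ∃ l : List V, (a :: l).IsChain r ∧ (a :: l).getLast? = some b ∧ (a :: l).Nodup := by
  induction h using Relation.ReflTransGen.head_induction_on with
  | refl => exact ⟨[], by simp⟩
  | @head x y hxy _ ih =>
    obtain ⟨l, hc, hl, hn⟩ := ih
    by_cases hx : x ∈ y :: l
    · obtain ⟨s, t, hst⟩ := List.append_of_mem hx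
      rw [hst] at hc hl hn
      refine ⟨t, hc.right_of_append, ?_, hn.of_append_right⟩
      rwa [List.getLast?_append_of_ne_nil _ (List.cons_ne_nil _ _)] at hl
    · exact ⟨y :: l, hc.cons_cons hxy, by simpa using hl, List.nodup_cons.2 ⟨hx, hn⟩⟩

/-- On a list without repetitions, the neighbours of an inner element are unique. -/
theorem neighbours_unique {p : List V} (hp : p.Nodup) {x y x' y' w : V}
    (h : [x, w, y] <:+: p) (h' : [x', w, y'] <:+: p) : x = x' ∧ y = y' := by
  obtain ⟨s, t, rfl⟩ := h
  obtain ⟨s', t', h'⟩ := h'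
  have key : (s' ++ [x']) ++ w :: (y' :: t') = (s ++ [x]) ++ w :: (y :: t) := by simpa using h'
  have hn : ((s ++ [x]) ++ w :: (y :: t)).Nodup := by simpa using hp
  have hn' := key ▸ hn
  have h₂ : w ∉ s' ++ [x'] := fun hw => (List.nodup_append.1 hn').2.2 w hw w (by simp) rfl
  have h₃ : w ∉ y' :: t' := (List.nodup_cons.1 hn'.of_append_right).1
  have := (List.append_cons_inj_of_notMem h₂ h₃).1 key
  simp at this
  grind

theorem infix_tail {p l : List V} (x : V) (h : p <:+: l) : p <:+: x :: l :=
  List.infix_cons_iff.2 (.inr h)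

theorem infix_three (x w y : V) (l : List V) : [x, w, y] <:+: x :: w :: y :: l :=
  ⟨[], l, by simp⟩

/-- The target of an edge pointing along a path belongs to any ancestral set that contains the end
of the path and all its colliders. -/
theorem mem_of_edge_along {E : V → V → Prop} {W : Set V} (hW : ∀ u v, E u v → v ∈ W → u ∈ W)
    {b : V} (hb : b ∈ W) (l : List V) (x v : V) (hc : (x :: v :: l).IsChain (Adj E))
    (hl : (x :: v :: l).getLast? = some b)
    (hcol : ∀ u w y, [u, w, y] <:+: x :: v :: l → E u w → E y w → w ∈ W) (hxv : E x v) :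
    v ∈ W := by
  induction l generalizing x v with
  | nil =>
    obtain rfl : v = b := by simpa using hl
    exact hb
  | cons y l ih =>
    rw [List.isChain_cons_cons] at hc
    obtain hvy | hyv := (List.isChain_cons_cons.1 hc.2).1
    · exact hW v y hvy (ih v y hc.2 (by simpa using hl)
        (fun u w z h => hcol u w z (infix_tail x h)) hvy)
    · exact hcol x v y (infix_three x v y l) hxv hyv

theorem forall_mem_of_path {E : V → V → Prop} {W : Set V} (hW : ∀ u v, E u v → v ∈ W → u ∈ W)
    {b : V} (hb : b ∈ W) (l : List V) (x : V) (hx : x ∈ W) (hc : (x :: l).IsChain (Adj E))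
    (hl : (x :: l).getLast? = some b)
    (hcol : ∀ u w y, [u, w, y] <:+: x :: l → E u w → E y w → w ∈ W) :
    ∀ w ∈ x :: l, w ∈ W := by
  induction l generalizing x with
  | nil => simpa using hx
  | cons v l ih =>
    have hv : v ∈ W := by
      obtain hxv | hvx := (List.isChain_cons_cons.1 hc).1
      · exact mem_of_edge_along hW hb l x v hc hl hcol hxv
      · exact hW v x hvx hx
    have := ih v hv (List.isChain_cons_cons.1 hc).2 (by simpa using hl)
      (fun u w z h => hcol u w z (infix_tail x h))
    intro w hw
    obtain rfl | hw := List.mem_cons.1 hw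
    · exact hx
    · exact this w hw

/-- Skipping the colliders turns a path of `E` inside `W` into a walk of the moral graph. -/
theorem moral_reachable_of_path {E : V → V → Prop} (hE : Acyclic E) {W S : Set V} {b : V}
    (hb : b ∉ S) (l : List V) (u : V) (hu : u ∉ S) (hc : (u :: l).IsChain (Adj E))
    (hl : (u :: l).getLast? = some b) (hlW : ∀ w ∈ u :: l, w ∈ W)
    (hS : ∀ x w y, [x, w, y] <:+: u :: l → ¬ (E x w ∧ E y w) → w ∉ S) :
    Relation.ReflTransGen (fun x y => MoralAdj E W x y ∧ x ∉ S ∧ y ∉ S) u b := by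
  match l with
  | [] =>
    obtain rfl : u = b := by simpa using hl
    exact .refl
  | [v] =>
    obtain rfl : v = b := by simpa using hl
    have huv : Adj E u v := (List.isChain_cons_cons.1 hc).1
    refine .single ⟨⟨hlW u (by simp), hlW v (by simp), ?_, ?_⟩, hu, hb⟩
    · exact huv.elim hE.ne fun h => (hE.ne h).symm
    · exact huv.elim .inl fun h => .inr (.inl h)
  | v :: y :: l =>
    have huv : Adj E u v := (List.isChain_cons_cons.1 hc).1
    have hc' := (List.isChain_cons_cons.1 hc).2
    by_cases hv : E u v ∧ E y v
    · have hy : y ∉ S := by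
        match l with
        | [] =>
          obtain rfl : y = b := by simpa using hl
          exact hb
        | z :: l =>
          exact hS v y z (infix_tail u (infix_three v y z l)) fun h => hE.not_edge hv.2 h.1
      have hyb := moral_reachable_of_path hE hb l y hy (List.isChain_cons_cons.1 hc').2
        (by simpa using hl) (fun w hw => hlW w (by simp_all))
        (fun x w z h => hS x w z (infix_tail u (infix_tail v h)))
      by_cases huy : u = y
      · rwa [huy]
      · exact .head ⟨⟨hlW u (by simp), hlW y (by simp), huy,
          .inr (.inr ⟨v, hlW v (by simp), hv⟩)⟩, hu, hy⟩ hyb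
    · have hv' : v ∉ S := hS u v y (infix_three u v y l) hv
      refine .head ⟨⟨hlW u (by simp), hlW v (by simp), ?_, ?_⟩, hu, hv'⟩
        (moral_reachable_of_path hE hb (y :: l) v hv' hc' (by simpa using hl)
          (fun w hw => hlW w (List.mem_cons_of_mem _ hw))
          (fun x w z h => hS x w z (infix_tail u h)))
      · exact huv.elim hE.ne fun h => (hE.ne h).symm
      · exact huv.elim .inl fun h => .inr (.inl h)

theorem dsep_of_moralSeparates {E : V → V → Prop} (hE : Acyclic E) {A B S : Set V}
    (hAS : Disjoint A S) (hBS : Disjoint B S) (h : MoralSeparates E A B S) : DSep E A B S := by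
  rintro a ha b hb p ⟨hc, hhead, hlast, hn⟩ ⟨hcol, hnon⟩
  obtain ⟨l, rfl⟩ : ∃ l, p = a :: l := by
    cases p with
    | nil => simp at hhead
    | cons x l => exact ⟨l, by simp_all⟩
  change (a :: l).IsChain (Adj E) at hc
  have haS : a ∉ S := Set.disjoint_left.1 hAS ha
  have hbS : b ∉ S := Set.disjoint_left.1 hBS hb
  have hlW : ∀ w ∈ a :: l, w ∈ An E (A ∪ B ∪ S) :=
    forall_mem_of_path (fun u v huv hv => mem_An_of_reflTransGen (.single huv) hv)
      (subset_An E _ (.inl (.inr hb))) l a (subset_An E _ (.inl (.inl ha))) hc hlast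
      (fun u w y hi h₁ h₂ => An_mono E Set.subset_union_right (hcol w ⟨u, y, hi, h₁, h₂⟩))
  have hreach := moral_reachable_of_path hE hbS l a haS hc hlast hlW (by
    intro x w y hi hw
    refine hnon w (hi.subset (by simp)) ?_
    rintro ⟨x', y', hi', hx', hy'⟩
    obtain ⟨rfl, rfl⟩ := neighbours_unique hn hi hi'
    exact hw ⟨hx', hy'⟩)
  obtain ⟨q, hq, hqb, hqn⟩ := exists_nodup_chain_of_reflTransGen hreach
  obtain ⟨s, hs, hsq⟩ := h a ha b hb (a :: q) (hq.imp fun _ _ h => h.1) rfl hqb hqn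
  have : ∀ w ∈ a :: q, w ∉ S := by
    refine hq.induction (fun w => w ∉ S) (a :: q) (fun _ _ h _ => h.2.2) ?_
    simpa using haS
  exact this s hsq hs

/-- `Trail E A S l m`: read backwards, `l` is a path without repetitions starting in `A` on which
every inner vertex satisfies the condition for connecting paths relative to `S`; `m` records
whether the last edge points at the current vertex, the head of `l`. -/
inductive Trail (E : V → V → Prop) (A S : Set V) : List V → Bool → Prop
  | start (a : V) (ha : a ∈ A) : Trail E A S [a] false
  | forward (v w : V) (l : List V) (m : Bool) (h : Trail E A S (v :: l) m) (hvw : E v w)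
      (hv : v ∉ S) (hw : w ∉ v :: l) : Trail E A S (w :: v :: l) true
  | backward (v w : V) (l : List V) (m : Bool) (h : Trail E A S (v :: l) m) (hwv : E w v)
      (hv : m = false ∧ v ∉ S ∨ m = true ∧ v ∈ An E S) (hw : w ∉ v :: l) :
      Trail E A S (w :: v :: l) false

/-- A trail can be cut at each of its inner vertices `w`. Either `w ∈ An S` and the shortened
trail arrives at `w` by an arrow, or `w ∉ S`; in the latter case the shortened trail arrives by a
tail, or the part cut off is a directed path from `w`. -/
theorem Trail.cut {E : V → V → Prop} {A S : Set V} {p : List V} {m : Bool}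
    (h : Trail E A S p m) : ∀ v l, p = v :: l → ∀ w ∈ l, ∃ l' m', Trail E A S (w :: l') m' ∧
      (m' = true ∧ w ∈ An E S ∨
        w ∉ S ∧ (m' = false ∨ m = true ∧ Relation.ReflTransGen E w v)) := by
  induction h with
  | start a ha =>
    rintro v l hp w hw
    simp_all
  | forward v u l m h hvu hv hu ih =>
    rintro _ _ ⟨⟩ w hw
    obtain rfl | hw := List.mem_cons.1 hw
    · exact ⟨l, m, h, .inr ⟨hv, .inr ⟨rfl, .single hvu⟩⟩⟩
    · obtain ⟨l', m', h', h₁ | ⟨hwS, h₁ | ⟨-, h₁⟩⟩⟩ := ih v l rfl w hw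
      · exact ⟨l', m', h', .inl h₁⟩
      · exact ⟨l', m', h', .inr ⟨hwS, .inl h₁⟩⟩
      · exact ⟨l', m', h', .inr ⟨hwS, .inr ⟨rfl, h₁.tail hvu⟩⟩⟩
  | backward v u l m h huv hv hu ih =>
    rintro _ _ ⟨⟩ w hw
    obtain rfl | hw := List.mem_cons.1 hw
    · obtain ⟨hm, hv⟩ | hv := hv
      · exact ⟨l, m, h, .inr ⟨hv, .inl hm⟩⟩
      · exact ⟨l, m, h, .inl hv⟩
    · obtain ⟨l', m', h', h₁ | ⟨hwS, h₁ | ⟨rfl, h₁⟩⟩⟩ := ih v l rfl w hw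
      · exact ⟨l', m', h', .inl h₁⟩
      · exact ⟨l', m', h', .inr ⟨hwS, .inl h₁⟩⟩
      · have hv : v ∈ An E S := by simpa using hv
        cases m' with
        | false => exact ⟨l', false, h', .inr ⟨hwS, .inl rfl⟩⟩
        | true => exact ⟨l', true, h', .inl ⟨rfl, mem_An_of_reflTransGen h₁ hv⟩⟩

/-- Some trail ends at `v` and can be continued at least as well as one arriving with mark `m`. -/
def Reaches (E : V → V → Prop) (A S : Set V) (v : V) (m : Bool) : Prop :=
  ∃ l m', Trail E A S (v :: l) m' ∧
    (m' = m ∨ m = true ∧ v ∉ S ∨ m = false ∧ v ∈ An E S)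

theorem Reaches.start {E : V → V → Prop} {A : Set V} (S : Set V) {a : V} (ha : a ∈ A) :
    Reaches E A S a false :=
  ⟨[], false, .start a ha, .inl rfl⟩

theorem Reaches.forward {E : V → V → Prop} (hE : Acyclic E) {A S : Set V} {v w : V} {m : Bool}
    (h : Reaches E A S v m) (hv : v ∉ S) (hvw : E v w) : Reaches E A S w true := by
  obtain ⟨l, m', h, -⟩ := h
  by_cases hw : w ∈ v :: l
  · obtain rfl | hw := List.mem_cons.1 hw
    · exact (hE.ne hvw rfl).elim
    · obtain ⟨l', m'', h', h₁ | h₁⟩ := h.cut v l rfl w hw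
      · exact ⟨l', m'', h', .inl h₁.1⟩
      · exact ⟨l', m'', h', .inr (.inl ⟨rfl, h₁.1⟩)⟩
  · exact ⟨v :: l, true, .forward v w l m' h hvw hv hw, .inl rfl⟩

theorem Reaches.backward {E : V → V → Prop} (hE : Acyclic E) {A S : Set V} {v w : V} {m : Bool}
    (h : Reaches E A S v m) (hv : m = false ∧ v ∉ S ∨ m = true ∧ v ∈ An E S) (hwv : E w v) :
    Reaches E A S w false := by
  obtain ⟨l, m', h, hm⟩ := h
  have hv' : m' = false ∧ v ∉ S ∨ m' = true ∧ v ∈ An E S := by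
    cases m <;> cases m' <;> simp_all
  by_cases hw : w ∈ v :: l
  · obtain rfl | hw := List.mem_cons.1 hw
    · exact (hE.ne hwv rfl).elim
    · obtain ⟨l', m'', h', h₁ | ⟨-, h₁ | ⟨rfl, h₁⟩⟩⟩ := h.cut v l rfl w hw
      · exact ⟨l', m'', h', .inr (.inr ⟨rfl, h₁.2⟩)⟩
      · exact ⟨l', m'', h', .inl h₁⟩
      · have hv : v ∈ An E S := by simpa using hv'
        exact ⟨l', m'', h', .inr (.inr ⟨rfl, mem_An_of_reflTransGen h₁ hv⟩)⟩
  · exact ⟨v :: l, false, .backward v w l m' h hwv hv' hw, .inl rfl⟩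

/-- Following directed edges outside `An S`, downwards. -/
theorem Reaches.descend {E : V → V → Prop} (hE : Acyclic E) {A S : Set V} {v w : V} {m : Bool}
    (h : Reaches E A S v m) (hv : v ∉ An E S) (hvw : Relation.ReflTransGen E v w) :
    ∃ m', Reaches E A S w m' := by
  induction hvw with
  | refl => exact ⟨m, h⟩
  | @tail x y hvx hxy ih =>
    obtain ⟨m', h'⟩ := ih
    exact ⟨true, h'.forward hE (fun hx => hv ⟨x, hx, hvx⟩) hxy⟩

/-- Following directed edges outside `An S`, upwards from a vertex of `A`. -/
theorem reaches_of_ancestor {E : V → V → Prop} (hE : Acyclic E) {A S : Set V} {v a : V}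
    (ha : a ∈ A) (hv : v ∉ An E S) (hva : Relation.ReflTransGen E v a) :
    Reaches E A S v false := by
  induction hva using Relation.ReflTransGen.head_induction_on with
  | refl => exact .start S ha
  | @head x y hxy _ ih =>
    have hy : y ∉ An E S := fun hy => hv (mem_An_of_reflTransGen (.single hxy) hy)
    exact (ih hy).backward hE (.inl ⟨rfl, fun h => hy (subset_An E S h)⟩) hxy

/-- The parents of a reached vertex of `An (A ∪ B ∪ S)` are reached as well, or `B` is reached,
provided that the vertex is reached by an arrow or lies outside `S`. -/
theorem Reaches.parent {E : V → V → Prop} (hE : Acyclic E) {A B S : Set V} {v w : V} {m : Bool}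
    (h : Reaches E A S v m) (hv : v ∈ An E (A ∪ B ∪ S)) (hvm : m = true ∨ v ∉ S) (hwv : E w v) :
    (∃ b ∈ B, ∃ m', Reaches E A S b m') ∨ Reaches E A S w false := by
  cases m with
  | false => exact .inr (h.backward hE (.inl ⟨rfl, by simpa using hvm⟩) hwv)
  | true =>
    by_cases hvS : v ∈ An E S
    · exact .inr (h.backward hE (.inr ⟨rfl, hvS⟩) hwv)
    · obtain ⟨x, (hx | hx) | hx, hvx⟩ := hv
      · exact .inr ((reaches_of_ancestor hE hx hvS hvx).backward hE
          (.inl ⟨rfl, fun h => hvS (subset_An E S h)⟩) hwv)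
      · exact .inl ⟨x, hx, h.descend hE hvS hvx⟩
      · exact (hvS ⟨x, hx, hvx⟩).elim

theorem Reaches.moralAdj {E : V → V → Prop} (hE : Acyclic E) {A B S : Set V} {v w : V} {m : Bool}
    (h : Reaches E A S v m) (hv : v ∉ S) (hvw : MoralAdj E (An E (A ∪ B ∪ S)) v w) :
    (∃ b ∈ B, ∃ m', Reaches E A S b m') ∨ ∃ m', Reaches E A S w m' := by
  obtain ⟨hvW, -, -, hvw | hwv | ⟨c, hc, hvc, hwc⟩⟩ := hvw
  · exact .inr ⟨true, h.forward hE hv hvw⟩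
  · exact (h.parent hE hvW (.inr hv) hwv).imp_right fun h => ⟨_, h⟩
  · exact ((h.forward hE hv hvc).parent hE hc (.inl rfl) hwc).imp_right fun h => ⟨_, h⟩

theorem reaches_of_moral_path {E : V → V → Prop} (hE : Acyclic E) {A B S : Set V} {b : V}
    (hb : b ∈ B) (l : List V) (v : V) (m : Bool) (h : Reaches E A S v m)
    (hc : (v :: l).IsChain (MoralAdj E (An E (A ∪ B ∪ S)))) (hl : (v :: l).getLast? = some b)
    (hS : ∀ w ∈ v :: l, w ∉ S) : ∃ b ∈ B, ∃ m', Reaches E A S b m' := by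
  induction l generalizing v m with
  | nil =>
    obtain rfl : v = b := by simpa using hl
    exact ⟨v, hb, m, h⟩
  | cons w l ih =>
    rw [List.isChain_cons_cons] at hc
    obtain h' | ⟨m', h'⟩ := h.moralAdj hE (hS v (by simp)) hc.1
    · exact h'
    · exact ih w m' h' hc.2 (by simpa using hl) fun x hx => hS x (List.mem_cons_of_mem _ hx)

theorem Trail.isChain {E : V → V → Prop} {A S : Set V} {p : List V} {m : Bool}
    (h : Trail E A S p m) : p.IsChain (Adj E) := by
  induction h with
  | start a ha => simp
  | forward v w l m h hvw hv hw ih => exact ih.cons_cons (.inr hvw)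
  | backward v w l m h hwv hv hw ih => exact ih.cons_cons (.inl hwv)

theorem Trail.nodup {E : V → V → Prop} {A S : Set V} {p : List V} {m : Bool}
    (h : Trail E A S p m) : p.Nodup := by
  induction h with
  | start a ha => simp
  | forward v w l m h hvw hv hw ih => exact List.nodup_cons.2 ⟨hw, ih⟩
  | backward v w l m h hwv hv hw ih => exact List.nodup_cons.2 ⟨hw, ih⟩

theorem Trail.getLast? {E : V → V → Prop} {A S : Set V} {p : List V} {m : Bool}
    (h : Trail E A S p m) : ∃ a ∈ A, p.getLast? = some a := by
  induction h with
  | start a ha => exact ⟨a, ha, rfl⟩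
  | forward v w l m h hvw hv hw ih => simpa using ih
  | backward v w l m h hwv hv hw ih => simpa using ih

/-- The mark of a trail is `true` exactly when its last edge points at its current vertex. -/
theorem Trail.mark {E : V → V → Prop} {A S : Set V} {p : List V} {m : Bool}
    (h : Trail E A S p m) (v : V) (l : List V) (hp : p = v :: l) :
    (m = true → ∃ x l', l = x :: l' ∧ E x v) ∧ (m = false → ∀ x l', l = x :: l' → E v x) := by
  cases h <;> cases hp <;> simp_all

theorem IsCollider.cons {E : V → V → Prop} {p : List V} {w : V} (u : V)
    (h : IsCollider E p w) : IsCollider E (u :: p) w := by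
  obtain ⟨x, y, hi, hx, hy⟩ := h
  exact ⟨x, y, infix_tail u hi, hx, hy⟩

theorem IsCollider.of_cons {E : V → V → Prop} {l : List V} {u v w : V}
    (h : IsCollider E (u :: v :: l) w) :
    IsCollider E (v :: l) w ∨ w = v ∧ E u v ∧ ∃ y l', l = y :: l' ∧ E y v := by
  obtain ⟨x, y, hi, hx, hy⟩ := h
  obtain ⟨t, ht⟩ | hi := List.infix_cons_iff.1 hi
  · simp only [List.cons_append, List.nil_append, List.cons.injEq] at ht
    obtain ⟨rfl, rfl, rfl⟩ := ht
    exact .inr ⟨rfl, hx, y, t, rfl, hy⟩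
  · exact .inl ⟨x, y, hi, hx, hy⟩

theorem Trail.collider_mem {E : V → V → Prop} (hE : Acyclic E) {A S : Set V} {p : List V}
    {m : Bool} (h : Trail E A S p m) : ∀ w, IsCollider E p w → w ∈ An E S := by
  induction h with
  | start a ha =>
    rintro w ⟨x, y, hi, -, -⟩
    simpa using hi.length_le
  | forward v u l m h hvu hv hu ih =>
    intro w hw
    obtain hw | ⟨-, huv, -⟩ := hw.of_cons
    · exact ih w hw
    · exact (hE.not_edge hvu huv).elim
  | backward v u l m h huv hv hu ih =>
    intro w hw
    obtain hw | ⟨rfl, -, y, l', hl, hyv⟩ := hw.of_cons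
    · exact ih w hw
    · obtain ⟨hm, -⟩ | ⟨-, hv⟩ := hv
      · exact (hE.not_edge hyv ((h.mark w l rfl).2 hm y l' hl)).elim
      · exact hv

theorem Trail.notMem_of_not_collider {E : V → V → Prop} {A S : Set V} {p : List V} {m : Bool}
    (h : Trail E A S p m) :
    ∀ v l, p = v :: l → ∀ w ∈ l, ¬ IsCollider E p w → w ∉ S := by
  induction h with
  | start a ha =>
    rintro v l hp w hw
    simp_all
  | forward v u l m h hvu hv hu ih =>
    rintro _ _ ⟨⟩ w hw hn
    obtain rfl | hw := List.mem_cons.1 hw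
    · exact hv
    · exact ih v l rfl w hw fun hw => hn (hw.cons u)
  | backward v u l m h huv hv hu ih =>
    rintro _ _ ⟨⟩ w hw hn
    obtain rfl | hw := List.mem_cons.1 hw
    · obtain ⟨-, hv⟩ | ⟨hm, -⟩ := hv
      · exact hv
      · obtain ⟨x, l', rfl, hx⟩ := (h.mark w l rfl).1 hm
        exact (hn ⟨u, x, infix_three u w x l', huv, hx⟩).elim
    · exact ih v l rfl w hw fun hw => hn (hw.cons u)

theorem isCollider_reverse {E : V → V → Prop} {p : List V} {w : V} :
    IsCollider E p.reverse w ↔ IsCollider E p w := by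
  have key : ∀ q : List V, IsCollider E q w → IsCollider E q.reverse w := by
    rintro q ⟨x, y, hi, hx, hy⟩
    exact ⟨y, x, by simpa using List.reverse_infix.2 hi, hy, hx⟩
  exact ⟨fun h => by simpa using key _ h, key p⟩

theorem moralSeparates_of_dsep {E : V → V → Prop} (hE : Acyclic E) {A B S : Set V}
    (hBS : Disjoint B S) (h : DSep E A B S) : MoralSeparates E A B S := by
  intro a ha b hb p hc hhead hlast _
  by_contra! hS
  obtain ⟨l, rfl⟩ : ∃ l, p = a :: l := by
    cases p with
    | nil => simp at hhead
    | cons x l => exact ⟨l, by simp_all⟩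
  obtain ⟨b', hb', -, q, m, ht, -⟩ :=
    reaches_of_moral_path hE hb l a false (.start S ha) hc hlast fun w hw hwS => hS w hwS hw
  obtain ⟨a', ha', hlast'⟩ := ht.getLast?
  refine h a' ha' b' hb' (b' :: q).reverse ⟨?_, ?_, ?_, ?_⟩ ⟨?_, ?_⟩
  · change List.IsChain _ _
    rw [List.isChain_reverse]
    exact ht.isChain.imp fun _ _ h => h.symm
  · rw [List.head?_reverse, hlast']
  · rw [List.getLast?_reverse, List.head?_cons]
  · exact List.nodup_reverse.2 ht.nodup
  · exact fun w hw => ht.collider_mem hE w (isCollider_reverse.1 hw)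
  · intro w hw hn
    rw [isCollider_reverse] at hn
    obtain rfl | hw := List.mem_cons.1 (List.mem_reverse.1 hw)
    · exact Set.disjoint_left.1 hBS hb'
    · exact ht.notMem_of_not_collider b' q rfl w hw hn

/-- **Proposition (d-separation = separation in the moral ancestral graph).**
For disjoint subsets `A`, `B`, `S` of a finite DAG, `A ⊥_D B | S` holds iff `S` separates
`A` from `B` in the moral graph of the subgraph induced by the smallest ancestral set
containing `A ∪ B ∪ S`. -/
theorem dsep_iff_moralSeparates [Fintype V] (E : V → V → Prop) (hE : Acyclic E)
    (A B S : Set V) (hAB : Disjoint A B) (hAS : Disjoint A S) (hBS : Disjoint B S) :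
    DSep E A B S ↔ MoralSeparates E A B S := by
  exact ⟨moralSeparates_of_dsep hE hBS, dsep_of_moralSeparates hE hAS hBS⟩

end MoralSep
end

section
/- Let D be a directed acyclic graph on V = {1, …, d} and let ⊥σ be a semi-graphoid independence model over V. If ⊥σ satisfies the well-ordered Markov property (O) with respect to one well-ordering of V compatible with D, then it satisfies (O) with respect to every well-ordering of V compatible with D. -/
namespace OrderedMarkovInvariance

variable {d : ℕ}

/-- The parents of `v` in the DAG `E`. -/
def pa (E : Fin d → Fin d → Prop) (v : Fin d) : Set (Fin d) := {u | E u v}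

/-- `σ` is a well-ordering of the DAG `E`: the vertex at position `i` is `σ i`, and every
edge points from a lower to a higher position. -/
def IsWellOrdering (E : Fin d → Fin d → Prop) (σ : Equiv.Perm (Fin d)) : Prop :=
  ∀ i j, E (σ i) (σ j) → i < j

/-- The well-ordered Markov property (O) of an independence model `I` with respect to the
well-ordering `σ`: every vertex is independent of its predecessors (minus its parents)
given its parents. -/
def OrderedMarkov (E : Fin d → Fin d → Prop) (σ : Equiv.Perm (Fin d))
    (I : Set (Fin d) → Set (Fin d) → Set (Fin d) → Prop) : Prop :=
  ∀ i : Fin d, I {σ i} ({w | ∃ j, j < i ∧ σ j = w} \ pa E (σ i)) (pa E (σ i))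

/-- **The well-ordered Markov property does not depend on the chosen well-ordering:**
if a semi-graphoid independence model satisfies (O) w.r.t. one well-ordering of the DAG,
it satisfies (O) w.r.t. every well-ordering of the DAG. -/
theorem orderedMarkov_of_orderedMarkov
    (E : Fin d → Fin d → Prop)
    (I : Set (Fin d) → Set (Fin d) → Set (Fin d) → Prop)
    -- (S1) symmetry
    (hS1 : ∀ A B C : Set (Fin d), Disjoint A B → Disjoint A C → Disjoint B C →
      I A B C → I B A C)
    -- (S2) decomposition
    (hS2 : ∀ A B C D : Set (Fin d), Disjoint A B → Disjoint A C → Disjoint A D →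
      Disjoint B C → Disjoint B D → Disjoint C D →
      I A (B ∪ D) C → I A B C ∧ I A D C)
    -- (S3) weak union
    (hS3 : ∀ A B C D : Set (Fin d), Disjoint A B → Disjoint A C → Disjoint A D →
      Disjoint B C → Disjoint B D → Disjoint C D →
      I A (B ∪ D) C → I A B (C ∪ D))
    -- (S4) contraction
    (hS4 : ∀ A B C D : Set (Fin d), Disjoint A B → Disjoint A C → Disjoint A D →
      Disjoint B C → Disjoint B D → Disjoint C D →
      I A B C → I A D (B ∪ C) → I A (B ∪ D) C)
    (σ₁ σ₂ : Equiv.Perm (Fin d))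
    (hσ₁ : IsWellOrdering E σ₁) (hσ₂ : IsWellOrdering E σ₂)
    (hO : OrderedMarkov E σ₁ I) :
    OrderedMarkov E σ₂ I := by
  have mono : ∀ A B B' C : Set (Fin d), B' ⊆ B → Disjoint A B → Disjoint A C → Disjoint B C →
      I A B C → I A B' C := by
    intro A B B' C hB hAB hAC hBC h
    refine (hS2 A B' C (B \ B') (hAB.mono_right hB) hAC (hAB.mono_right Set.sdiff_subset)
      (hBC.mono_left hB) Set.disjoint_sdiff_right (hBC.symm.mono_right Set.sdiff_subset) ?_).1
    rwa [Set.union_sdiff_cancel hB]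
  have e₁ : ∀ u w, E u w → σ₁.symm u < σ₁.symm w := fun u w h => hσ₁ _ _ (by simpa using h)
  have e₂ : ∀ u w, E u w → σ₂.symm u < σ₂.symm w := fun u w h => hσ₂ _ _ (by simpa using h)
  have hO' : ∀ v, I {v} ({w | σ₁.symm w < σ₁.symm v} \ pa E v) (pa E v) := by
    intro v
    have h := hO (σ₁.symm v)
    have hset : {w | ∃ j, j < σ₁.symm v ∧ σ₁ j = w} = {w | σ₁.symm w < σ₁.symm v} := by
      ext w
      constructor
      · rintro ⟨j, hj, rfl⟩
        simpa using hj
      · exact fun hw => ⟨σ₁.symm w, hw, by simp⟩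
    rwa [hset, Equiv.apply_symm_apply] at h
  intro i
  obtain ⟨v, rfl⟩ : ∃ v, σ₂.symm v = i := ⟨σ₂ i, by simp⟩
  rw [Equiv.apply_symm_apply]
  have hv : Disjoint {v} (pa E v) :=
    Set.disjoint_singleton_left.2 fun h => lt_irrefl _ (e₁ v v h)
  -- Add the `σ₂`-predecessors of `v` one at a time, in the order given by `σ₁`.
  let N : ℕ → Set (Fin d) := fun n =>
    {w | (σ₁.symm w : ℕ) < n ∧ σ₂.symm w < σ₂.symm v} \ pa E v
  have hvN : ∀ n, Disjoint {v} (N n) := fun n =>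
    Set.disjoint_singleton_left.2 fun h => lt_irrefl _ h.1.2
  have key : ∀ n : ℕ, (σ₁.symm v : ℕ) ≤ n → I {v} (N n) (pa E v) := by
    intro n hn
    induction n, hn using Nat.le_induction with
    | base =>
      refine mono _ _ _ _ ?_ ?_ hv Set.disjoint_sdiff_left (hO' v)
      · exact fun w hw => ⟨hw.1.1, hw.2⟩
      · exact Set.disjoint_singleton_left.2 fun h => lt_irrefl (σ₁.symm v) h.1
    | succ n hn ih =>
      by_cases hw : ∃ w, (σ₁.symm w : ℕ) = n ∧ w ∈ N (n + 1)
      · obtain ⟨w, hwn, ⟨-, hw₂⟩, hwp⟩ := hw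
        have hvw : v ≠ w := fun h => lt_irrefl _ (h ▸ hw₂)
        have hpos : σ₁.symm v < σ₁.symm w := by
          have : σ₁.symm v ≠ σ₁.symm w := σ₁.symm.injective.ne hvw
          exact lt_of_le_of_ne (Fin.le_def.2 (hn.trans hwn.ge)) this
        have hvpw : ¬ E v w := fun h => lt_asymm (e₂ v w h) hw₂
        have hNS : N (n + 1) = N n ∪ {w} := by
          ext x
          constructor
          · rintro ⟨⟨hx₁, hx₂⟩, hxp⟩
            rcases (Nat.lt_succ_iff.1 hx₁).lt_or_eq with h | h
            · exact Or.inl ⟨⟨h, hx₂⟩, hxp⟩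
            · exact Or.inr (σ₁.symm.injective (Fin.ext (h.trans hwn.symm)))
          · rintro (⟨⟨hx₁, hx₂⟩, hxp⟩ | rfl)
            · exact ⟨⟨hx₁.trans n.lt_succ_self, hx₂⟩, hxp⟩
            · exact ⟨⟨hwn.trans_lt n.lt_succ_self, hw₂⟩, hwp⟩
        have hwN : w ∉ N n := fun h => by have := h.1.1; omega
        have hvN' : v ∉ N n := Set.disjoint_singleton_left.1 (hvN n)
        have hvp : v ∉ pa E v := Set.disjoint_singleton_left.1 hv
        have hww : w ∉ pa E w := fun h => lt_irrefl _ (e₁ w w h)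
        have hpw : pa E w ⊆ N n ∪ pa E v := by
          intro u hu
          by_cases huv : u ∈ pa E v
          · exact Or.inr huv
          · exact Or.inl ⟨⟨hwn ▸ Fin.lt_def.1 (e₁ u w hu), (e₂ u w hu).trans hw₂⟩, huv⟩
        have h₁ : I {w} ({v} ∪ ((N n ∪ pa E v) \ pa E w)) (pa E w) := by
          refine mono _ _ _ _ ?_ ?_ ?_ Set.disjoint_sdiff_left (hO' w)
          · rintro x (rfl | ⟨hx | hx, hxw⟩)
            · exact ⟨hpos, hvpw⟩
            · exact ⟨Fin.lt_def.2 (hwn ▸ hx.1.1), hxw⟩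
            · exact ⟨(e₁ x v hx).trans hpos, hxw⟩
          · exact Set.disjoint_singleton_left.2 fun h => lt_irrefl (σ₁.symm w) h.1
          · exact Set.disjoint_singleton_left.2 hww
        have h₂ : I {w} {v} (N n ∪ pa E v) := by
          have h := hS3 {w} {v} (pa E w) ((N n ∪ pa E v) \ pa E w)
            (by simpa using hvw.symm) (Set.disjoint_singleton_left.2 hww)
            (Set.disjoint_singleton_left.2 fun h => h.1.elim hwN hwp)
            (Set.disjoint_singleton_left.2 hvpw)
            (Set.disjoint_singleton_left.2 fun h => h.1.elim hvN' hvp)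
            Set.disjoint_sdiff_right h₁
          rwa [Set.union_sdiff_cancel hpw] at h
        have h₃ : I {v} {w} (N n ∪ pa E v) :=
          hS1 _ _ _ (by simpa using hvw.symm)
            (Set.disjoint_singleton_left.2 fun h => h.elim hwN hwp)
            (Set.disjoint_singleton_left.2 fun h => h.elim hvN' hvp) h₂
        rw [hNS]
        exact hS4 _ _ _ _ (hvN n) hv (by simpa using hvw) Set.disjoint_sdiff_left
          (Set.disjoint_singleton_right.2 hwN) (Set.disjoint_singleton_right.2 hwp) ih h₃
      · have hNS : N (n + 1) = N n := by
          ext x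
          constructor
          · intro hx
            have hne : (σ₁.symm x : ℕ) ≠ n := fun h => hw ⟨x, h, hx⟩
            exact ⟨⟨lt_of_le_of_ne (Nat.lt_succ_iff.1 hx.1.1) hne, hx.1.2⟩, hx.2⟩
          · exact fun hx => ⟨⟨hx.1.1.trans n.lt_succ_self, hx.1.2⟩, hx.2⟩
        rwa [hNS]
  have hset : {w | ∃ j, j < σ₂.symm v ∧ σ₂ j = w} \ pa E v = N d := by
    ext w
    constructor
    · rintro ⟨⟨j, hj, rfl⟩, hw⟩
      exact ⟨⟨Fin.is_lt _, by simpa using hj⟩, hw⟩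
    · exact fun hw => ⟨⟨σ₂.symm w, hw.1.2, by simp⟩, hw.2⟩
  rw [hset]
  exact key d (Fin.is_lt _).le

end OrderedMarkovInvariance
end

section
/- Two directed acyclic graphs D1 = (V, E1) and D2 = (V, E2) on the same vertex set are Markov equivalent (i.e., their d-separation independence models coincide: for all disjoint A, B, C ⊆ V, A ⊥_{D1} B | C if and only if A ⊥_{D2} B | C) if and only if they have the same skeleton and the same unshielded colliders. -/
namespace MarkovEquivalence

variable {V : Type*}

/-- Adjacency in the underlying undirected graph (the skeleton). -/
def Adj (E : V → V → Prop) (a b : V) : Prop := E a b ∨ E b a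

/-- `E` is a DAG: no directed cycles (in particular no self-loops). -/
def Acyclic (E : V → V → Prop) : Prop := ∀ v, ¬ Relation.TransGen E v v

/-- `p` is a path from `a` to `b` in the underlying undirected graph of `E`. -/
def IsPathList (E : V → V → Prop) (a b : V) (p : List V) : Prop :=
  p.Chain' (Adj E) ∧ p.head? = some a ∧ p.getLast? = some b ∧ p.Nodup

/-- `w` is a collider on the path `p`. -/
def IsCollider (E : V → V → Prop) (p : List V) (w : V) : Prop :=
  ∃ x y, [x, w, y] <:+: p ∧ E x w ∧ E y w

/-- The smallest ancestral set containing `S`. -/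
def An (E : V → V → Prop) (S : Set V) : Set V :=
  {u | ∃ v ∈ S, Relation.ReflTransGen E u v}

/-- The path `p` is connecting relative to `S`. -/
def Connecting (E : V → V → Prop) (S : Set V) (p : List V) : Prop :=
  (∀ w, IsCollider E p w → w ∈ An E S) ∧ (∀ w ∈ p, ¬ IsCollider E p w → w ∉ S)

/-- d-separation in the DAG `E`. -/
def DSep (E : V → V → Prop) (A B S : Set V) : Prop :=
  ∀ a ∈ A, ∀ b ∈ B, ∀ p : List V, IsPathList E a b p → ¬ Connecting E S p

/-- `(u, w, v)` is an unshielded collider of `E`: `u → w ← v` with `u` and `v`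
distinct and non-adjacent. -/
def UnshieldedCollider (E : V → V → Prop) (u w v : V) : Prop :=
  E u w ∧ E v w ∧ u ≠ v ∧ ¬ Adj E u v

open Relation

theorem Adj.symm {E : V → V → Prop} {a b : V} (h : Adj E a b) : Adj E b a := Or.symm h

theorem Acyclic.irrefl {E : V → V → Prop} (h : Acyclic E) (a : V) : ¬ E a a :=
  fun e => h a (.single e)

theorem Acyclic.asymm {E : V → V → Prop} (h : Acyclic E) {a b : V} (e : E a b) : ¬ E b a :=
  fun e' => h a (.head e (.single e'))

theorem Acyclic.not_reflTransGen {E : V → V → Prop} (h : Acyclic E) {a b : V} (e : E a b) :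
    ¬ ReflTransGen E b a :=
  fun e' => h a (.head' e e')

theorem subset_An {E : V → V → Prop} {S : Set V} {v : V} (h : v ∈ S) : v ∈ An E S :=
  ⟨v, h, .refl⟩

theorem mem_An_of_edge {E : V → V → Prop} {S : Set V} {u v : V} (e : E u v)
    (h : v ∈ An E S) : u ∈ An E S := by
  obtain ⟨s, hs, h⟩ := h
  exact ⟨s, hs, h.head e⟩

/-- `u` and `v` are vertices of `U` outside `S` that are adjacent in the moral graph of `E`
restricted to `U`. -/
def MoralStep (E : V → V → Prop) (S U : Set V) (u v : V) : Prop :=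
  (u ∈ U ∧ u ∉ S) ∧ (v ∈ U ∧ v ∉ S) ∧ (Adj E u v ∨ ∃ c ∈ U, E u c ∧ E v c)

theorem MoralStep.symm {E : V → V → Prop} {S U : Set V} {u v : V} (h : MoralStep E S U u v) :
    MoralStep E S U v u := by
  obtain ⟨hu, hv, h | ⟨c, hc, h, h'⟩⟩ := h
  · exact ⟨hv, hu, .inl h.symm⟩
  · exact ⟨hv, hu, .inr ⟨c, hc, h', h⟩⟩

/-- `a` and `b` are connected outside `S` in the moral graph of the smallest ancestral set
containing `a`, `b` and `S`. -/
def MoralConn (E : V → V → Prop) (S : Set V) (a b : V) : Prop :=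
  ReflTransGen (MoralStep E S (An E ({a, b} ∪ S))) a b

/-- `E'` arises from `E` by reversing the edge `x → y`, which is covered: `x` and `y` have the
same parents apart from `x` itself. -/
structure CoveredReversal (E E' : V → V → Prop) (x y : V) : Prop where
  edge : E x y
  edge' : E' y x
  not_edge : ¬ E y x
  not_edge' : ¬ E' x y
  agree : ∀ a b, ¬ (a = x ∧ b = y) → ¬ (a = y ∧ b = x) → (E a b ↔ E' a b)
  parents : ∀ z, z ≠ x → z ≠ y → (E z x ↔ E z y)

namespace CoveredReversal

variable {E E' : V → V → Prop} {x y : V}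

theorem symm (h : CoveredReversal E E' x y) : CoveredReversal E' E y x where
  edge := h.edge'
  edge' := h.edge
  not_edge := h.not_edge'
  not_edge' := h.not_edge
  agree a b h₁ h₂ := (h.agree a b h₂ h₁).symm
  parents z h₁ h₂ := by
    rw [← h.agree z y (by tauto) (by tauto), ← h.agree z x (by tauto) (by tauto)]
    exact (h.parents z h₂ h₁).symm

theorem adj_iff (h : CoveredReversal E E' x y) (a b : V) : Adj E a b ↔ Adj E' a b := by
  have h₁ := h.edge
  have h₂ := h.edge'
  have h₃ := h.agree a b
  have h₄ := h.agree b a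
  unfold Adj
  by_cases a = x ∧ b = y <;> by_cases a = y ∧ b = x <;> grind

theorem acyclic (h : CoveredReversal E E' x y) (hE : Acyclic E) : Acyclic E' := by
  have key : ∀ a b, TransGen E' a b → b ≠ x → b ≠ y →
      (a = y → TransGen E x b) ∧ (a ≠ y → TransGen E a b) := by
    intro a b hab hx hy
    induction hab using TransGen.head_induction_on with
    | single e =>
      rename_i a
      have e' := (h.agree a b (by tauto) (by tauto)).2 e
      exact ⟨fun ha => .head h.edge (.single (ha ▸ e')), fun _ => .single e'⟩
    | head e hcb ih =>
      rename_i a c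
      constructor
      · rintro rfl
        by_cases hc : c = x
        · subst hc
          exact ih.2 (fun hh => hE.irrefl _ (hh ▸ h.edge))
        · have hac := (h.agree _ c (by rintro ⟨h₁, -⟩; exact hE.irrefl _ (h₁ ▸ h.edge))
            (by tauto)).2 e
          exact .head h.edge (.head hac (ih.2 (fun hh => hE.irrefl _ (hh ▸ hac))))
      · intro ha
        have hac : E a c := by
          by_cases hh : a = x ∧ c = y
          · obtain ⟨rfl, rfl⟩ := hh
            exact h.edge
          · exact (h.agree a c hh (by tauto)).2 e
        by_cases hc : c = y
        · have hax : a ≠ x := by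
            rintro rfl
            exact h.not_edge' (hc ▸ e)
          exact .head ((h.parents a hax ha).2 (hc ▸ hac)) (ih.1 hc)
        · exact .head hac (ih.2 hc)
  have hcyc : ∀ v, v ≠ x → v ≠ y → ¬ TransGen E' v v :=
    fun v hx hy hv => hE v ((key v v hv hx hy).2 hy)
  have next : ∀ v, TransGen E' v v → ∃ c, E' v c ∧ TransGen E' c c := by
    intro v hv
    obtain ⟨c, hc, hcv⟩ := TransGen.head'_iff.1 hv
    exact ⟨c, hc, TransGen.tail' hcv hc⟩
  have hx : ¬ TransGen E' x x := by
    intro hv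
    obtain ⟨c, hc, hcc⟩ := next x hv
    refine hcyc c ?_ ?_ hcc
    · rintro rfl
      have hne : c ≠ y := fun hh => hE.irrefl c (by simpa [← hh] using h.edge)
      exact hE.irrefl c ((h.agree c c (by tauto) (by tauto)).2 hc)
    · rintro rfl
      exact h.not_edge' hc
  intro v hv
  by_cases h₁ : v = x
  · exact hx (h₁ ▸ hv)
  by_cases h₂ : v = y
  · subst h₂
    obtain ⟨c, hc, hcc⟩ := next v hv
    by_cases hcx : c = x
    · exact hx (hcx ▸ hcc)
    refine hcyc c hcx ?_ hcc
    rintro rfl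
    exact hE.irrefl c ((h.agree c c (by tauto) (by tauto)).2 hc)
  · exact hcyc v h₁ h₂ hv

theorem unshieldedCollider (h : CoveredReversal E E' x y) (hE : Acyclic E) {u w v : V}
    (hc : UnshieldedCollider E u w v) : UnshieldedCollider E' u w v := by
  obtain ⟨h₁, h₂, h₃, h₄⟩ := hc
  rw [h.adj_iff] at h₄
  have key : ∀ u v, E u w → E v w → u ≠ v → ¬ Adj E' u v → E' u w := by
    intro u v h₁ h₂ h₃ h₄
    refine (h.agree u w ?_ ?_).1 h₁
    · rintro ⟨rfl, rfl⟩
      refine h₄ ((h.adj_iff _ _).1 (.inr ((h.parents v h₃.symm ?_).2 h₂)))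
      rintro rfl
      exact hE.irrefl _ h₂
    · rintro ⟨rfl, rfl⟩
      exact h.not_edge h₁
  exact ⟨key u v h₁ h₂ h₃ h₄, key v u h₂ h₁ h₃.symm (fun hh => h₄ hh.symm), h₃, h₄⟩

theorem mem_An (h : CoveredReversal E E' x y) (hE : Acyclic E) {T : Set V} {v : V}
    (hv : v ∈ An E T) : v ∈ An E' T ∨ (v = x ∧ y ∈ An E' T) := by
  obtain ⟨t, ht, hvt⟩ := hv
  induction hvt using ReflTransGen.head_induction_on with
  | refl => exact .inl (subset_An ht)
  | head e hct ih =>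
    rename_i v c
    by_cases hxy : v = x ∧ c = y
    · obtain ⟨rfl, rfl⟩ := hxy
      rcases ih with ih | ⟨rfl, ih⟩
      · exact .inr ⟨rfl, ih⟩
      · exact absurd e (hE.irrefl _)
    have hyx : ¬ (v = y ∧ c = x) := by
      rintro ⟨rfl, rfl⟩
      exact h.not_edge e
    rcases ih with ih | ⟨rfl, ih⟩
    · exact .inl (mem_An_of_edge ((h.agree v c hxy hyx).1 e) ih)
    · have h₁ : v ≠ c := fun hh => hE.irrefl _ (hh ▸ e)
      have h₂ : v ≠ y := fun hh => hyx ⟨hh, rfl⟩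
      exact .inl (mem_An_of_edge ((h.agree v y (by tauto) (by tauto)).1
        ((h.parents v h₁ h₂).1 e)) ih)

theorem moralConn (h : CoveredReversal E E' x y) (hE : Acyclic E) {S : Set V} {a b : V}
    (hab : MoralConn E S a b) : MoralConn E' S a b := by
  unfold MoralConn at *
  have hU : ∀ v, v ∈ An E ({a, b} ∪ S) →
      v ∈ An E' ({a, b} ∪ S) ∨ (v = x ∧ y ∈ An E' ({a, b} ∪ S)) := fun v => h.mem_An hE
  have haU : a ∈ An E' ({a, b} ∪ S) := subset_An (by simp)
  have hbU : b ∈ An E' ({a, b} ∪ S) := subset_An (by simp)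
  set U := An E ({a, b} ∪ S) with hUdef
  set U' := An E' ({a, b} ∪ S) with hUdef'
  have hne : x ≠ y := fun hh => hE.irrefl x (by simpa [← hh] using h.edge)
  have hpar : ∀ v, E v y → v ≠ x → E v x := fun v e hv =>
    (h.parents v hv (fun hh => hE.irrefl _ (hh ▸ e))).2 e
  by_cases hx : x ∈ U → x ∈ U'
  · have hsub : ∀ v, v ∈ U → v ∈ U' := by
      intro v hv
      rcases hU v hv with h' | ⟨rfl, -⟩
      · exact h'
      · exact hx hv
    refine ReflTransGen.trans_induction_on hab (fun _ => .refl) ?_ (fun _ _ => .trans)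
    rintro u v ⟨⟨hu, huS⟩, ⟨hv, hvS⟩, huv⟩
    by_cases hEq : u = v
    · exact hEq ▸ .refl
    refine .single ⟨⟨hsub u hu, huS⟩, ⟨hsub v hv, hvS⟩, ?_⟩
    rcases huv with huv | ⟨c, hc, h₁, h₂⟩
    · exact .inl ((h.adj_iff u v).1 huv)
    by_cases hA : u = x ∧ c = y
    · obtain ⟨rfl, rfl⟩ := hA
      exact .inl ((h.adj_iff _ _).1 (.inr (hpar v h₂ (Ne.symm hEq))))
    by_cases hB : v = x ∧ c = y
    · obtain ⟨rfl, rfl⟩ := hB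
      exact .inl ((h.adj_iff _ _).1 (.inl (hpar u h₁ hEq)))
    have hC : ∀ w, E w c → ¬ (w = y ∧ c = x) := by
      rintro w e ⟨rfl, rfl⟩
      exact h.not_edge e
    exact .inr ⟨c, hsub c hc, (h.agree u c hA (hC u h₁)).1 h₁, (h.agree v c hB (hC v h₂)).1 h₂⟩
  · push Not at hx
    obtain ⟨hxU, hxU'⟩ := hx
    have hyU' : y ∈ U' := by
      rcases hU x hxU with h' | h'
      · exact absurd h' hxU'
      · exact h'.2
    have hsub : ∀ v, v ∈ U → v ≠ x → v ∈ U' := by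
      intro v hv hvx
      rcases hU v hv with h' | h'
      · exact h'
      · exact absurd h'.1 hvx
    have hchild : ∀ v, v ∈ U → E x v → v = y := by
      intro v hv e
      by_contra hvy
      refine hxU' (mem_An_of_edge ((h.agree x v (by tauto) (by tauto)).1 e) (hsub v hv ?_))
      exact fun hh => hE.irrefl _ (hh ▸ e)
    have hnbr : ∀ v, MoralStep E S U x v → v ≠ x → v = y ∨ E v x := by
      rintro v ⟨-, ⟨hv, -⟩, (e | e) | ⟨c, hc, h₁, h₂⟩⟩ hvx
      · exact .inl (hchild v hv e)
      · exact .inr e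
      · obtain rfl := hchild c hc h₁
        exact .inr (hpar v h₂ hvx)
    have hpar' : ∀ v, E v x → E' v y := by
      intro v e
      have h₁ : v ≠ x := fun hh => hE.irrefl _ (hh ▸ e)
      have h₂ : v ≠ y := fun hh => h.not_edge (hh ▸ e)
      exact (h.agree v y (by tauto) (by tauto)).1 ((h.parents v h₁ h₂).1 e)
    have hclique : ∀ d e, (d = y ∨ E d x) → (e = y ∨ E e x) → (d ∈ U' ∧ d ∉ S) →
        (e ∈ U' ∧ e ∉ S) → ReflTransGen (MoralStep E' S U') d e := by
      rintro d e (rfl | hd) (rfl | he) hdS heS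
      · exact .refl
      · exact .single ⟨hdS, heS, .inl (.inr (hpar' e he))⟩
      · exact .single ⟨hdS, heS, .inl (.inl (hpar' d hd))⟩
      · exact .single ⟨hdS, heS, .inr ⟨y, hyU', hpar' d hd, hpar' e he⟩⟩
    have key : (b ≠ x → ReflTransGen (MoralStep E' S U') a b) ∧
        (b = x → ∃ d, (d = y ∨ E d x) ∧ (d ∈ U' ∧ d ∉ S) ∧
          ReflTransGen (MoralStep E' S U') a d) := by
      clear hbU hUdef hUdef'
      clear_value U U'
      induction hab with
      | refl => exact ⟨fun _ => .refl, fun hh => absurd (hh ▸ haU) hxU'⟩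
      | tail hau huv ih =>
        rename_i u v
        by_cases hux : u = x <;> by_cases hvx : v = x
        · simpa [hux, hvx] using ih
        · refine ⟨fun _ => ?_, fun hh => absurd hh hvx⟩
          obtain ⟨d, hd, hdU, had⟩ := ih.2 hux
          subst hux
          exact had.trans (hclique d v hd (hnbr v huv hvx) hdU
            ⟨hsub v huv.2.1.1 hvx, huv.2.1.2⟩)
        · refine ⟨fun hh => absurd hvx hh, fun _ => ?_⟩
          subst hvx
          exact ⟨u, hnbr u huv.symm hux, ⟨hsub u huv.1.1 hux, huv.1.2⟩, ih.1 hux⟩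
        · refine ⟨fun _ => (ih.1 hux).trans ?_, fun hh => absurd hh hvx⟩
          obtain ⟨⟨hu, huS⟩, ⟨hv, hvS⟩, huv⟩ := huv
          have hu' := hsub u hu hux
          have hv' := hsub v hv hvx
          rcases huv with huv | ⟨c, hc, h₁, h₂⟩
          · exact .single ⟨⟨hu', huS⟩, ⟨hv', hvS⟩, .inl ((h.adj_iff u v).1 huv)⟩
          by_cases hcx : c = x
          · subst hcx
            exact hclique u v (.inr h₁) (.inr h₂) ⟨hu', huS⟩ ⟨hv', hvS⟩
          · exact .single ⟨⟨hu', huS⟩, ⟨hv', hvS⟩, .inr ⟨c, hsub c hc hcx,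
              (h.agree u c (by tauto) (by tauto)).1 h₁,
              (h.agree v c (by tauto) (by tauto)).1 h₂⟩⟩
    exact key.1 (fun hh => hxU' (hh ▸ hbU))

end CoveredReversal

theorem exists_coveredReversal [Finite V] {E₁ E₂ : V → V → Prop} (h₁ : Acyclic E₁)
    (h₂ : Acyclic E₂) (hadj : ∀ u v, Adj E₁ u v ↔ Adj E₂ u v)
    (hcol : ∀ u w v, UnshieldedCollider E₁ u w v ↔ UnshieldedCollider E₂ u w v)
    (hne : ∃ x y, E₁ x y ∧ E₂ y x) :
    ∃ x y E', E₁ x y ∧ E₂ y x ∧ CoveredReversal E₁ E' x y := by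
  have : Std.Irrefl (TransGen E₁) := ⟨h₁⟩
  have : Std.Irrefl (Function.swap (TransGen E₁)) := ⟨h₁⟩
  have : IsTrans V (Function.swap (TransGen E₁)) := ⟨fun _ _ _ h h' => h'.trans h⟩
  obtain ⟨x₀, y₀, hx₀⟩ := hne
  obtain ⟨y, ⟨x₁, hx₁⟩, hymin⟩ :=
    (Finite.wellFounded_of_trans_of_irrefl (TransGen E₁)).has_min
      {y | ∃ x, E₁ x y ∧ E₂ y x} ⟨y₀, x₀, hx₀⟩
  obtain ⟨x, ⟨hxy, hyx⟩, hxmax⟩ :=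
    (Finite.wellFounded_of_trans_of_irrefl (Function.swap (TransGen E₁))).has_min
      {x | E₁ x y ∧ E₂ y x} ⟨x₁, hx₁⟩
  have hymin' : ∀ z w, E₁ z w → TransGen E₁ w y → E₂ z w := by
    intro z w e hw
    rcases (hadj z w).1 (.inl e) with h | h
    · exact h
    · exact absurd hw (hymin w ⟨z, e, h⟩)
  have hxmax' : ∀ z, E₁ z y → E₁ x z → E₂ z y := by
    intro z e hw
    rcases (hadj z y).1 (.inl e) with h | h
    · exact h
    · exact absurd (.single hw) (hxmax z ⟨e, h⟩)
  refine ⟨x, y, fun a b => (E₁ a b ∧ ¬ (a = x ∧ b = y)) ∨ (a = y ∧ b = x), hxy, hyx,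
    hxy, .inr ⟨rfl, rfl⟩, h₁.asymm hxy, ?_, fun a b h h' => ?_, fun z hzx hzy => ⟨?_, ?_⟩⟩
  · rintro (h | ⟨h, -⟩)
    · exact h.2 ⟨rfl, rfl⟩
    · exact h₁.irrefl x (by simpa [← h] using hxy)
  · tauto
  · intro e
    have e₂ := hymin' z x e (.single hxy)
    by_contra hn
    have hna : ¬ Adj E₁ z y := by
      rintro (h | h)
      · exact hn h
      · exact h₁ z (.head e (.head hxy (.single h)))
    have := (hcol z x y).2 ⟨e₂, hyx, hzy, fun h => hna ((hadj _ _).2 h)⟩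
    exact h₁.asymm hxy this.2.1
  · intro e
    have ha : Adj E₁ z x := by
      by_contra hn
      have := (hcol z y x).1 ⟨e, hxy, hzx, hn⟩
      exact h₂.asymm hyx this.2.1
    rcases ha with h | h
    · exact h
    exfalso
    have e₂ := hxmax' z e h
    exact h₂ z (.head e₂ (.head hyx (.single (hymin' x z h (.single e)))))

theorem MoralConn.of_equiv [Finite V] {E₁ E₂ : V → V → Prop} (h₁ : Acyclic E₁)
    (h₂ : Acyclic E₂) (hadj : ∀ u v, Adj E₁ u v ↔ Adj E₂ u v)
    (hcol : ∀ u w v, UnshieldedCollider E₁ u w v ↔ UnshieldedCollider E₂ u w v)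
    {S : Set V} {a b : V} (h : MoralConn E₁ S a b) : MoralConn E₂ S a b := by
  induction hn : Set.ncard {p : V × V | E₁ p.1 p.2 ∧ E₂ p.2 p.1} using Nat.strong_induction_on
    generalizing E₁ with
  | _ n ih =>
  by_cases hne : ∃ x y, E₁ x y ∧ E₂ y x
  · obtain ⟨x, y, E', hxy, hyx, hr⟩ := exists_coveredReversal h₁ h₂ hadj hcol hne
    refine ih _ ?_ (hr.acyclic h₁) (fun u v => (hr.adj_iff u v).symm.trans (hadj u v))
      (fun u w v => Iff.trans ⟨hr.symm.unshieldedCollider (hr.acyclic h₁),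
        hr.unshieldedCollider h₁⟩ (hcol u w v)) (hr.moralConn h₁ h) rfl
    rw [← hn]
    refine Set.ncard_lt_ncard ?_ (Set.toFinite _)
    refine (Set.ssubset_iff_of_subset ?_).2 ⟨(x, y), ⟨hxy, hyx⟩, fun hh => hr.not_edge' hh.1⟩
    rintro ⟨u, v⟩ ⟨e, e'⟩
    refine ⟨(hr.agree u v ?_ ?_).2 e, e'⟩
    · rintro ⟨rfl, rfl⟩
      exact hr.not_edge' e
    · rintro ⟨rfl, rfl⟩
      exact h₂.asymm hyx e'
  · have : E₁ = E₂ := by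
      push Not at hne
      funext u v
      have := hne u v
      have := hne v u
      have := hadj u v
      have := h₂.asymm (a := u) (b := v)
      unfold Adj at *
      grind
    exact this ▸ h

/-- Every consecutive triple of `p` is unblocked by `S`. -/
def ActiveTriples (E : V → V → Prop) (S : Set V) (p : List V) : Prop :=
  ∀ x w y, [x, w, y] <:+: p →
    (E x w → E y w → w ∈ An E S) ∧ (¬ (E x w ∧ E y w) → w ∉ S)

namespace ActiveTriples

variable {E : V → V → Prop} {S : Set V}

theorem mono {p q : List V} (h : ActiveTriples E S q) (hp : p <:+: q) : ActiveTriples E S p :=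
  fun x w y hx => h x w y (hx.trans hp)

theorem singleton (a : V) : ActiveTriples E S [a] := fun _ _ _ h => by
  have := h.length_le
  simp at this

theorem pair (a b : V) : ActiveTriples E S [a, b] := fun _ _ _ h => by
  have := h.length_le
  simp at this

theorem cons {x w y : V} {l : List V} (h : ActiveTriples E S (w :: y :: l))
    (h₁ : E x w → E y w → w ∈ An E S) (h₂ : ¬ (E x w ∧ E y w) → w ∉ S) :
    ActiveTriples E S (x :: w :: y :: l) := by
  intro x' w' y' h'
  rcases List.infix_cons_iff.1 h' with h' | h'
  · simp only [List.cons_prefix_cons] at h'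
    obtain ⟨rfl, rfl, rfl, -⟩ := h'
    exact ⟨h₁, h₂⟩
  · exact h x' w' y' h'

theorem head {x w y : V} {l : List V} (h : ActiveTriples E S (x :: w :: y :: l)) :
    (E x w → E y w → w ∈ An E S) ∧ (¬ (E x w ∧ E y w) → w ∉ S) :=
  h x w y ⟨[], l, rfl⟩

theorem tail {x : V} {l : List V} (h : ActiveTriples E S (x :: l)) : ActiveTriples E S l :=
  h.mono (List.suffix_cons x l).isInfix

/-- An active path that starts along an edge `x → w` is directed, or `x` is an ancestor
of `S`. -/
theorem mem_An_or_isChain {x w : V} {l : List V} (h : ActiveTriples E S (x :: w :: l))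
    (hc : List.IsChain (Adj E) (x :: w :: l)) (e : E x w) :
    x ∈ An E S ∨ List.IsChain E (x :: w :: l) := by
  induction l generalizing x w with
  | nil => exact .inr (by simpa using e)
  | cons y l ih =>
    by_cases hy : E y w
    · exact .inl (mem_An_of_edge e (h.head.1 e hy))
    · have hwy : E w y := ((List.isChain_cons_cons.1 hc.tail).1).resolve_right hy
      rcases ih h.tail hc.tail hwy with h' | h'
      · exact .inl (mem_An_of_edge e h')
      · exact .inr (h'.cons_cons e)

theorem mem_An_or_reflTransGen {x w b : V} {l : List V} (h : ActiveTriples E S (x :: w :: l))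
    (hc : List.IsChain (Adj E) (x :: w :: l)) (e : E x w)
    (hb : (x :: w :: l).getLast? = some b) :
    x ∈ An E S ∨ Relation.ReflTransGen E x b := by
  refine (h.mem_An_or_isChain hc e).imp_right fun h' => ?_
  have := List.relationReflTransGen_of_exists_isChain _ h' (List.cons_ne_nil _ _)
  rw [List.getLast?_eq_some_getLast (List.cons_ne_nil _ _)] at hb
  simpa [Option.some.inj hb] using this

end ActiveTriples

theorem triple_unique {p : List V} (hp : p.Nodup) {x w y x' y' : V} (h : [x, w, y] <:+: p)
    (h' : [x', w, y'] <:+: p) : x = x' ∧ y = y' := by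
  induction p with
  | nil => simp at h
  | cons a p ih =>
    have key : ∀ {x y x' y' : V}, [x, w, y] <+: a :: p → ¬ [x', w, y'] <:+: p := by
      rintro x y x' y' ⟨r, hr⟩ ⟨s, t, ht⟩
      simp only [List.cons_append, List.nil_append, List.cons.injEq] at hr
      obtain ⟨rfl, rfl⟩ := hr
      have hp' := hp.of_cons
      cases s with
      | nil =>
        simp only [List.nil_append, List.cons_append, List.cons.injEq] at ht
        obtain ⟨rfl, hh⟩ := ht
        simp [← hh] at hp'
      | cons z s =>
        simp only [List.cons_append, List.cons.injEq] at ht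
        have : w ∈ y :: r := by simp [← ht.2]
        exact (List.nodup_cons.1 hp').1 this
    rcases List.infix_cons_iff.1 h with h | h <;> rcases List.infix_cons_iff.1 h' with h' | h'
    · simp only [List.cons_prefix_cons] at h h'
      obtain ⟨s, hs⟩ : [w, y] <+: p := h.2
      obtain ⟨t, ht⟩ : [w, y'] <+: p := h'.2
      refine ⟨h.1.trans h'.1.symm, ?_⟩
      have := hs.trans ht.symm
      simp only [List.cons_append, List.cons.injEq, true_and] at this
      exact this.1
    · exact absurd h' (key h)
    · exact absurd h (key h')
    · exact ih hp.of_cons h h'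

theorem Connecting.activeTriples {E : V → V → Prop} {S : Set V} {p : List V} (hp : p.Nodup)
    (h : Connecting E S p) : ActiveTriples E S p := by
  intro x w y hx
  refine ⟨fun h₁ h₂ => h.1 w ⟨x, y, hx, h₁, h₂⟩, fun hn => h.2 w (hx.subset (by simp)) ?_⟩
  rintro ⟨x', y', hx', h₁, h₂⟩
  obtain ⟨rfl, rfl⟩ := triple_unique hp hx hx'
  exact hn ⟨h₁, h₂⟩

theorem ActiveTriples.connecting {E : V → V → Prop} {S : Set V} {a b : V} {p : List V}
    (h : ActiveTriples E S p) (hp : IsPathList E a b p) (ha : a ∉ S) (hb : b ∉ S) :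
    Connecting E S p := by
  refine ⟨fun w ⟨x, y, hx, h₁, h₂⟩ => (h x w y hx).1 h₁ h₂, fun w hw hn => ?_⟩
  obtain ⟨s, t, rfl⟩ := List.append_of_mem hw
  rcases List.eq_nil_or_concat s with rfl | ⟨s, x, rfl⟩
  · have := hp.2.1
    simp only [List.nil_append, List.head?_cons, Option.some.injEq] at this
    exact this ▸ ha
  cases t with
  | nil =>
    have := hp.2.2.1
    simp only [List.getLast?_append, List.getLast?_singleton, Option.some_or,
      Option.some.injEq] at this
    exact this ▸ hb
  | cons y t =>
    have hx : [x, w, y] <:+: s.concat x ++ w :: y :: t := ⟨s, t, by simp⟩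
    simp only [List.concat_eq_append] at hn h hx
    exact (h x w y hx).2 fun hh => hn ⟨x, y, hx, hh⟩

theorem ActiveTriples.moralReachable {E : V → V → Prop} (hE : Acyclic E) {S U : Set V}
    (hU : ∀ u v, E u v → v ∈ U → u ∈ U) (hS : An E S ⊆ U) {a b : V} (l : List V)
    (h : ActiveTriples E S (a :: l)) (hc : List.IsChain (Adj E) (a :: l))
    (hlast : (a :: l).getLast? = some b) (haU : a ∈ U) (haS : a ∉ S) (hbU : b ∈ U)
    (hbS : b ∉ S) : Relation.ReflTransGen (MoralStep E S U) a b := by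
  have hU' : ∀ u v, Relation.ReflTransGen E u v → v ∈ U → u ∈ U := by
    intro u v huv hv
    induction huv using Relation.ReflTransGen.head_induction_on with
    | refl => exact hv
    | head e _ ih => exact hU _ _ e ih
  induction hn : l.length using Nat.strong_induction_on generalizing a l with
  | _ n ih =>
  match l, h, hc, hlast, hn with
  | [], _, _, hlast, _ =>
    simp only [List.getLast?_singleton, Option.some.injEq] at hlast
    exact hlast ▸ .refl
  | [c], _, hc, hlast, _ =>
    simp only [List.getLast?_cons_cons, List.getLast?_singleton, Option.some.injEq] at hlast
    subst hlast
    exact .single ⟨⟨haU, haS⟩, ⟨hbU, hbS⟩, .inl (List.isChain_cons_cons.1 hc).1⟩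
  | c :: y :: l, h, hc, hlast, hn =>
    have hac := (List.isChain_cons_cons.1 hc).1
    have hcy := (List.isChain_cons_cons.1 hc.tail).1
    rw [List.getLast?_cons_cons] at hlast
    have hcU : c ∈ U := by
      rcases hac with e | e
      · by_cases e' : E y c
        · exact hS (h.head.1 e e')
        · rcases h.tail.mem_An_or_reflTransGen hc.tail (hcy.resolve_right e') hlast with h' | h'
          · exact hS h'
          · exact hU' _ _ h' hbU
      · exact hU _ _ e haU
    by_cases hcS : c ∈ S
    · have hcol : E a c ∧ E y c := by
        by_contra hh
        exact h.head.2 hh hcS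
      have hyU : y ∈ U := hU _ _ hcol.2 hcU
      rw [List.getLast?_cons_cons] at hlast
      have hyS : y ∉ S := by
        cases l with
        | nil =>
          simp only [List.getLast?_singleton, Option.some.injEq] at hlast
          exact hlast ▸ hbS
        | cons z l => exact h.tail.head.2 fun hh => hE.asymm hcol.2 hh.1
      exact .head ⟨⟨haU, haS⟩, ⟨hyU, hyS⟩, .inr ⟨c, hcU, hcol⟩⟩
        (ih l.length (by simp [← hn]) l h.tail.tail hc.tail.tail hlast hyU hyS rfl)
    · exact .head ⟨⟨haU, haS⟩, ⟨hcU, hcS⟩, .inl hac⟩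
        (ih (l.length + 1) (by simp [← hn]) (y :: l) h.tail hc.tail hlast hcU hcS rfl)

/-- `ActiveWalk E S b t v` says that there is a walk from `v` to `b` active relative to `S`;
`t` records whether its first edge points into `v`. -/
inductive ActiveWalk (E : V → V → Prop) (S : Set V) (b : V) : Bool → V → Prop
  | nil : ActiveWalk E S b false b
  | into {t : Bool} {u v : V} : ActiveWalk E S b t u → u ∉ S → E u v → ActiveWalk E S b true v
  | chain {u v : V} : ActiveWalk E S b false u → u ∉ S → E v u → ActiveWalk E S b false v
  | collider {u v : V} : ActiveWalk E S b true u → u ∈ An E S → E v u →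
      ActiveWalk E S b false v

namespace ActiveWalk

variable {E : V → V → Prop} {S : Set V}

theorem of_reflTransGen_target {b d : V} (h : Relation.ReflTransGen E d b)
    (hd : d ∉ An E S) : ActiveWalk E S b false d := by
  induction h using Relation.ReflTransGen.head_induction_on with
  | refl => exact .nil
  | head e _ ih =>
    have hc := fun hh => hd (mem_An_of_edge e hh)
    exact .chain (ih hc) (fun hh => hc (subset_An hh)) e

theorem of_reflTransGen_source {a b d : V} {t : Bool} (h : Relation.ReflTransGen E d a)
    (hd : d ∉ An E S) (hw : ActiveWalk E S b t d) : ∃ t, ActiveWalk E S b t a := by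
  induction h using Relation.ReflTransGen.head_induction_on generalizing t with
  | refl => exact ⟨t, hw⟩
  | head e _ ih =>
    exact ih (fun hh => hd (mem_An_of_edge e hh)) (.into hw (fun hh => hd (subset_An hh)) e)

theorem extend {a b c k : V} {t : Bool} (hw : ActiveWalk E S b t k)
    (hk : k ∈ An E ({a, b} ∪ S)) (ht : t = false → k ∉ S) (e : E c k) :
    (∃ t, ActiveWalk E S b t a) ∨ ∃ t, ActiveWalk E S b t c := by
  cases t with
  | false => exact .inr ⟨_, .chain hw (ht rfl) e⟩
  | true =>
    by_cases hkS : k ∈ An E S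
    · exact .inr ⟨_, .collider hw hkS e⟩
    obtain ⟨s, (rfl | rfl) | hs, hks⟩ := hk
    · exact .inl (of_reflTransGen_source hks hkS hw)
    · exact .inr ⟨_, .chain (of_reflTransGen_target hks hkS) (fun hh => hkS (subset_An hh)) e⟩
    · exact absurd ⟨s, hs, hks⟩ hkS

theorem of_moralConn {a b : V} (h : MoralConn E S a b) : ∃ t, ActiveWalk E S b t a := by
  suffices H : ∀ c, Relation.ReflTransGen (MoralStep E S (An E ({a, b} ∪ S))) c b →
      (∃ t, ActiveWalk E S b t a) ∨ ∃ t, ActiveWalk E S b t c by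
    simpa using H a h
  intro c hc
  induction hc using Relation.ReflTransGen.head_induction_on with
  | refl => exact .inr ⟨_, .nil⟩
  | head hst _ ih =>
    rcases ih with ih | ⟨t, ih⟩
    · exact .inl ih
    obtain ⟨-, ⟨hdU, hdS⟩, (e | e) | ⟨k, hk, e, e'⟩⟩ := hst
    · exact ih.extend hdU (fun _ => hdS) e
    · exact .inr ⟨_, .into ih hdS e⟩
    · exact (ActiveWalk.into ih hdS e').extend hk (by simp) e

end ActiveWalk

/-- An edge into `v` may be put in front of the path `v :: l` without blocking it at `v`. -/
def CanPrepend (E : V → V → Prop) (S : Set V) (v : V) (l : List V) : Prop :=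
  ∀ w ∈ l.head?, (E w v → v ∈ An E S) ∧ (¬ E w v → v ∉ S)

theorem exists_path_prepend {E : V → V → Prop} (hE : Acyclic E) {S : Set V} {b u v : V}
    {l : List V} (hp : IsPathList E u b (u :: l)) (huv : Adj E v u)
    (hA : ActiveTriples E S (v :: u :: l)) :
    ∃ l', IsPathList E v b (v :: l') ∧ ActiveTriples E S (v :: l') ∧
      (E u v → v ∈ An E S → CanPrepend E S v l') ∧ (E v u → v ∉ S → CanPrepend E S v l') := by
  obtain ⟨hc, -, hlast, hnd⟩ := hp
  have hc' : List.IsChain (Adj E) (v :: u :: l) := List.isChain_cons_cons.2 ⟨huv, hc⟩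
  by_cases hv : v ∈ u :: l
  · have hne : v ≠ u := by
      rintro rfl
      rcases huv with e | e <;> exact hE.irrefl _ e
    obtain ⟨s, l', hs⟩ := List.append_of_mem hv
    have hsuf : v :: l' <:+ u :: l := ⟨s, hs.symm⟩
    refine ⟨l', ⟨hc.suffix hsuf, rfl, ?_, hnd.sublist hsuf.sublist⟩,
      hA.tail.mono hsuf.isInfix, fun _ hvS w hw => ⟨fun _ => hvS, fun hwv => ?_⟩,
      fun e hvS w hw => ⟨fun hwv => ?_, fun _ => hvS⟩⟩
    · rw [hs, List.getLast?_append_of_ne_nil _ (by simp)] at hlast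
      exact hlast
    · obtain ⟨l', rfl⟩ : ∃ l'', l' = w :: l'' := by
        cases l' <;> simp_all
      rcases List.eq_nil_or_concat s with rfl | ⟨s, x, rfl⟩
      · simp only [List.nil_append, List.cons.injEq] at hs
        exact absurd hs.1.symm hne
      · exact (hA.tail x v w ⟨s, l', by simp [hs]⟩).2 fun hh => hwv hh.2
    · obtain ⟨l', rfl⟩ : ∃ l'', l' = w :: l'' := by
        cases l' <;> simp_all
      refine (hA.mem_An_or_isChain hc' e).resolve_right fun h => ?_
      exact hE.asymm hwv (List.isChain_cons_cons.1 (h.tail.suffix hsuf)).1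
  · refine ⟨u :: l, ⟨hc', rfl, by rwa [List.getLast?_cons_cons], List.nodup_cons.2 ⟨hv, hnd⟩⟩,
      hA, fun e hvS w hw => ?_, fun e hvS w hw => ?_⟩
    · obtain rfl : u = w := by simpa using hw
      exact ⟨fun _ => hvS, fun h => absurd e h⟩
    · obtain rfl : u = w := by simpa using hw
      exact ⟨fun h => absurd e (hE.asymm h), fun _ => hvS⟩

theorem ActiveWalk.exists_path {E : V → V → Prop} (hE : Acyclic E) {S : Set V} {b v : V}
    {t : Bool} (h : ActiveWalk E S b t v) :
    ∃ l, IsPathList E v b (v :: l) ∧ ActiveTriples E S (v :: l) ∧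
      ((if t then v ∈ An E S else v ∉ S) → CanPrepend E S v l) := by
  induction h with
  | nil =>
    exact ⟨[], ⟨List.isChain_singleton _, rfl, rfl, List.nodup_singleton _⟩, .singleton _,
      fun _ _ hw => by simp at hw⟩
  | @into t u v _ hu e ih =>
    obtain ⟨l, hp, hA, -⟩ := ih
    have hA' : ActiveTriples E S (v :: u :: l) := by
      cases l with
      | nil => exact .pair _ _
      | cons y l => exact hA.cons (fun e' => absurd e (hE.asymm e')) fun _ => hu
    obtain ⟨l', h₁, h₂, h₃, -⟩ := exists_path_prepend hE hp (.inr e) hA'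
    exact ⟨l', h₁, h₂, fun h => h₃ e (by simpa using h)⟩
  | @chain u v _ hu e ih =>
    obtain ⟨l, hp, hA, hl⟩ := ih
    have hA' : ActiveTriples E S (v :: u :: l) := by
      cases l with
      | nil => exact .pair _ _
      | cons y l =>
        have := hl (by simpa using hu) y (by simp)
        exact hA.cons (fun _ => this.1) fun hn => this.2 fun h => hn ⟨e, h⟩
    obtain ⟨l', h₁, h₂, -, h₃⟩ := exists_path_prepend hE hp (.inl e) hA'
    exact ⟨l', h₁, h₂, fun h => h₃ e (by simpa using h)⟩
  | @collider u v _ hu e ih =>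
    obtain ⟨l, hp, hA, hl⟩ := ih
    have hA' : ActiveTriples E S (v :: u :: l) := by
      cases l with
      | nil => exact .pair _ _
      | cons y l =>
        have := hl (by simpa using hu) y (by simp)
        exact hA.cons (fun _ => this.1) fun hn => this.2 fun h => hn ⟨e, h⟩
    obtain ⟨l', h₁, h₂, -, h₃⟩ := exists_path_prepend hE hp (.inl e) hA'
    exact ⟨l', h₁, h₂, fun h => h₃ e (by simpa using h)⟩

theorem exists_connecting_iff_moralConn {E : V → V → Prop} (hE : Acyclic E) {S : Set V}
    {a b : V} (ha : a ∉ S) (hb : b ∉ S) :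
    (∃ p, IsPathList E a b p ∧ Connecting E S p) ↔ MoralConn E S a b := by
  constructor
  · rintro ⟨p, hp, hcon⟩
    cases p with
    | nil => simp [IsPathList] at hp
    | cons c l =>
      obtain rfl : c = a := by simpa using hp.2.1
      refine (hcon.activeTriples hp.2.2.2).moralReachable hE (fun _ _ => mem_An_of_edge) ?_ l
        hp.1 hp.2.2.1 (subset_An (by simp)) ha (subset_An (by simp)) hb
      rintro v ⟨s, hs, hvs⟩
      exact ⟨s, .inr hs, hvs⟩
  · intro h
    obtain ⟨t, h⟩ := ActiveWalk.of_moralConn h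
    obtain ⟨l, hp, hA, -⟩ := h.exists_path hE
    exact ⟨a :: l, hp, hA.connecting hp ha hb⟩

theorem DSep.of_equiv [Finite V] {E₁ E₂ : V → V → Prop} (h₁ : Acyclic E₁) (h₂ : Acyclic E₂)
    (hadj : ∀ u v, Adj E₁ u v ↔ Adj E₂ u v)
    (hcol : ∀ u w v, UnshieldedCollider E₁ u w v ↔ UnshieldedCollider E₂ u w v)
    {A B S : Set V} (hA : Disjoint A S) (hB : Disjoint B S) (h : DSep E₁ A B S) :
    DSep E₂ A B S := by
  intro a ha b hb p hp hcon
  have haS := hA.notMem_of_mem_left ha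
  have hbS := hB.notMem_of_mem_left hb
  obtain ⟨q, hq, hcon_q⟩ := (exists_connecting_iff_moralConn h₁ haS hbS).2
    (((exists_connecting_iff_moralConn h₂ haS hbS).1 ⟨p, hp, hcon⟩).of_equiv h₂ h₁
      (fun u v => (hadj u v).symm) (fun u w v => (hcol u w v).symm))
  exact h a ha b hb q hq hcon_q

/-- A vertex is separated by its parents from every nonadjacent nondescendant. -/
theorem DSep.of_parents {E : V → V → Prop} (hE : Acyclic E) {u v : V} (hne : u ≠ v)
    (hadj : ¬ Adj E u v) (hreach : ¬ Relation.ReflTransGen E u v) :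
    DSep E {u} {v} {z | E z u} := by
  rintro _ rfl _ rfl p hp hcon
  have hA := hcon.activeTriples hp.2.2.2
  obtain ⟨hc, hhead, hlast, -⟩ := hp
  match p, hc, hhead, hlast, hA with
  | [x], _, hhead, hlast, _ =>
    simp only [List.head?_cons, List.getLast?_singleton, Option.some.injEq] at hhead hlast
    exact hne (hhead.symm.trans hlast)
  | [x, w], hc, hhead, hlast, _ =>
    simp only [List.head?_cons, List.getLast?_cons_cons, List.getLast?_singleton,
      Option.some.injEq] at hhead hlast
    subst hhead hlast
    exact hadj (List.isChain_cons_cons.1 hc).1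
  | x :: w :: y :: l, hc, hhead, hlast, hA =>
    simp only [List.head?_cons, Option.some.injEq] at hhead
    subst hhead
    rcases (List.isChain_cons_cons.1 hc).1 with e | e
    · rcases hA.mem_An_or_reflTransGen hc e hlast with ⟨z, hz, hxz⟩ | h
      · exact hE.not_reflTransGen hz hxz
      · exact hreach h
    · exact hA.head.2 (fun hh => hE.asymm e hh.1) e

theorem not_dSep_of_adj {E : V → V → Prop} {S : Set V} {u v : V} (hne : u ≠ v)
    (hadj : Adj E u v) (hu : u ∉ S) (hv : v ∉ S) : ¬ DSep E {u} {v} S := by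
  intro h
  have hp : IsPathList E u v [u, v] :=
    ⟨List.isChain_cons_cons.2 ⟨hadj, List.isChain_singleton _⟩, rfl, rfl, by simpa using hne⟩
  exact h u rfl v rfl _ hp ((ActiveTriples.pair u v).connecting hp hu hv)

theorem not_dSep_of_triple {E : V → V → Prop} {S : Set V} {u w v : V} (hnd : [u, w, v].Nodup)
    (huw : Adj E u w) (hwv : Adj E w v) (hu : u ∉ S) (hv : v ∉ S)
    (h₁ : E u w → E v w → w ∈ An E S) (h₂ : ¬ (E u w ∧ E v w) → w ∉ S) :
    ¬ DSep E {u} {v} S := by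
  intro h
  have hp : IsPathList E u v [u, w, v] :=
    ⟨List.isChain_cons_cons.2 ⟨huw, List.isChain_cons_cons.2 ⟨hwv, List.isChain_singleton _⟩⟩,
      rfl, rfl, hnd⟩
  exact h u rfl v rfl _ hp (((ActiveTriples.pair w v).cons h₁ h₂).connecting hp hu hv)

theorem adj_of_dSep_iff {E₁ E₂ : V → V → Prop} (h₁ : Acyclic E₁) (h₂ : Acyclic E₂)
    (h : ∀ A B C : Set V, Disjoint A B → Disjoint A C → Disjoint B C →
      (DSep E₁ A B C ↔ DSep E₂ A B C)) {u v : V} (huv : Adj E₁ u v) : Adj E₂ u v := by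
  by_contra hn
  wlog hr : ¬ Relation.ReflTransGen E₂ u v generalizing u v
  · refine this huv.symm (fun hh => hn hh.symm) fun hr' => ?_
    push Not at hr
    rcases hr.cases_head with rfl | ⟨c, e, hc⟩
    · rcases huv with e | e <;> exact h₁.irrefl _ e
    · exact h₂.not_reflTransGen e (hc.trans hr')
  have hne : u ≠ v := fun hh => hr (hh ▸ .refl)
  have hu : u ∉ {z | E₂ z u} := h₂.irrefl u
  have hv : v ∉ {z | E₂ z u} := fun e => hn (.inr e)
  exact not_dSep_of_adj hne huv hu hv ((h _ _ _ (by simpa using hne) (by simpa using hu)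
    (by simpa using hv)).2 (.of_parents h₂ hne hn hr))

theorem unshieldedCollider_of_dSep_iff {E₁ E₂ : V → V → Prop} (h₁ : Acyclic E₁)
    (h : ∀ A B C : Set V, Disjoint A B → Disjoint A C → Disjoint B C →
      (DSep E₁ A B C ↔ DSep E₂ A B C)) (hadj : ∀ u v, Adj E₁ u v ↔ Adj E₂ u v) {u w v : V}
    (hc : UnshieldedCollider E₁ u w v) : UnshieldedCollider E₂ u w v := by
  wlog hr : ¬ Relation.ReflTransGen E₁ u v generalizing u v
  · have hc' : UnshieldedCollider E₁ v w u :=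
      ⟨hc.2.1, hc.1, hc.2.2.1.symm, fun hh => hc.2.2.2 hh.symm⟩
    obtain ⟨e₁, e₂, hne, hn⟩ := this hc' fun hr' => by
      push Not at hr
      rcases hr.cases_head with hh | ⟨c, e, hcv⟩
      · exact hc.2.2.1 hh
      · exact h₁.not_reflTransGen e (hcv.trans hr')
    exact ⟨e₂, e₁, hne.symm, fun hh => hn hh.symm⟩
  obtain ⟨e₁, e₂, hne, hn⟩ := hc
  have hu : u ∉ {z | E₁ z u} := h₁.irrefl u
  have hv : v ∉ {z | E₁ z u} := fun e => hn (.inr e)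
  have hnd : [u, w, v].Nodup := by
    have : u ≠ w := fun hh => h₁.irrefl w (by simpa [hh] using e₁)
    have : w ≠ v := fun hh => h₁.irrefl w (by simpa [← hh] using e₂)
    simp_all
  have hsep := DSep.of_parents h₁ hne hn hr
  have hcol : E₂ u w ∧ E₂ v w := by
    by_contra hcol
    refine not_dSep_of_triple hnd ((hadj _ _).1 (.inl e₁)) ((hadj _ _).1 (.inr e₂)) hu hv
      (fun e e' => absurd ⟨e, e'⟩ hcol) (fun _ => h₁.asymm e₁)
      ((h _ _ _ (by simpa using hne) (by simpa using hu) (by simpa using hv)).1 hsep)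
  exact ⟨hcol.1, hcol.2, hne, fun hh => hn ((hadj _ _).2 hh)⟩

/-- **Markov equivalence of DAGs (Frydenberg; Verma–Pearl).**  Two DAGs on the same finite
vertex set have identical d-separation independence models if and only if they have the
same skeleton and the same unshielded colliders. -/
theorem markov_equivalent_iff [Fintype V]
    (E₁ E₂ : V → V → Prop) (h₁ : Acyclic E₁) (h₂ : Acyclic E₂) :
    (∀ A B C : Set V, Disjoint A B → Disjoint A C → Disjoint B C →
      (DSep E₁ A B C ↔ DSep E₂ A B C)) ↔
    ((∀ u v, Adj E₁ u v ↔ Adj E₂ u v) ∧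
      (∀ u w v, UnshieldedCollider E₁ u w v ↔ UnshieldedCollider E₂ u w v)) := by
  constructor
  · intro h
    have h' : ∀ A B C : Set V, Disjoint A B → Disjoint A C → Disjoint B C →
        (DSep E₂ A B C ↔ DSep E₁ A B C) := fun A B C hAB hAC hBC => (h A B C hAB hAC hBC).symm
    have hadj : ∀ u v, Adj E₁ u v ↔ Adj E₂ u v := fun u v =>
      ⟨adj_of_dSep_iff h₁ h₂ h, adj_of_dSep_iff h₂ h₁ h'⟩
    exact ⟨hadj, fun u w v => ⟨unshieldedCollider_of_dSep_iff h₁ h hadj,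
      unshieldedCollider_of_dSep_iff h₂ h' fun u v => (hadj u v).symm⟩⟩
  · rintro ⟨hadj, hcol⟩ A B C - hAC hBC
    exact ⟨.of_equiv h₁ h₂ hadj hcol hAC hBC, .of_equiv h₂ h₁ (fun u v => (hadj u v).symm)
      (fun u w v => (hcol u w v).symm) hAC hBC⟩

end MarkovEquivalence
end

section
/- Let D be a well-ordered DAG on V = {1, …, d} with edge weights c_{vu} > 0 for u ∈ pa(v), let z_1, …, z_d be positive real numbers, and let x_1, …, x_d be defined recursively by x_v = max over u ∈ pa(v) of c_{vu} x_u, joined with z_v (i.e., x_v = (⋁_{u ∈ pa(v)} c_{vu} x_u) ∨ z_v). Then for every v, x_v = ⋁_{u ∈ An(v)} b_{vu} z_u, where b_{vu} is the maximum over all directed paths π from u to v of the product of the edge weights along π, b_{vv} = 1, and An(v) = an(v) ∪ {v}. -/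
open scoped Classical NNReal

namespace MaxLinear9

variable {d : ℕ}

/-- The weight of a directed path recorded as its list of vertices
`[k₀, k₁, …, kₙ]`: the product `∏ c (k_{l+1}) (k_l)` of the edge weights along it. -/
def pathWeight (c : Fin d → Fin d → ℝ≥0) (p : List (Fin d)) : ℝ≥0 :=
  (List.zipWith (fun a b => c b a) p p.tail).prod

/-- `p` is a directed path from `u` to `v` in the digraph `E`, recorded as its list of
vertices (the trivial path `[v]` from `v` to `v` is allowed). -/
def IsDirPath (E : Fin d → Fin d → Prop) (u v : Fin d) (p : List (Fin d)) : Prop :=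
  p.Chain' E ∧ p.head? = some u ∧ p.getLast? = some v

/-- `b` is the max-linear coefficient matrix of the DAG `E` with edge weights `c`:
`b v u` is the maximum over all directed paths `π` from `u` to `v` of the product of the
edge weights along `π` (this maximum is attained), and `b v u = 0` if there is no such
path, i.e. if `u ∉ An(v)`.  In particular `b v v = 1`. -/
def IsMLCoeff (E : Fin d → Fin d → Prop) (c : Fin d → Fin d → ℝ≥0)
    (b : Fin d → Fin d → ℝ≥0) : Prop :=
  ∀ v u,
    (∀ p, IsDirPath E u v p → pathWeight c p ≤ b v u) ∧
    ((∃ p, IsDirPath E u v p) → ∃ p, IsDirPath E u v p ∧ pathWeight c p = b v u) ∧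
    ((¬ ∃ p, IsDirPath E u v p) → b v u = 0)

theorem pathWeight_cons_cons (c : Fin d → Fin d → ℝ≥0) (u k : Fin d) (p : List (Fin d)) :
    pathWeight c (u :: k :: p) = c k u * pathWeight c (k :: p) := by
  simp [pathWeight]

theorem isDirPath_cons_cons {E : Fin d → Fin d → Prop} {u v a k : Fin d} {p : List (Fin d)} :
    IsDirPath E u v (a :: k :: p) ↔ a = u ∧ E u k ∧ IsDirPath E k v (k :: p) := by
  constructor
  · rintro ⟨h1, h2, h3⟩
    obtain rfl : a = u := by simpa using h2
    have h1' := List.isChain_cons_cons.1 h1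
    exact ⟨rfl, h1'.1, h1'.2, rfl, by simpa using h3⟩
  · rintro ⟨rfl, h1, h2, h3, h4⟩
    exact ⟨List.isChain_cons_cons.2 ⟨h1, h2⟩, rfl, by simpa using h4⟩

theorem isDirPath_singleton {E : Fin d → Fin d → Prop} {u v a : Fin d} :
    IsDirPath E u v [a] ↔ a = u ∧ a = v := by
  refine ⟨fun h => ⟨by simpa using h.2.1, by simpa using h.2.2⟩, ?_⟩
  rintro ⟨rfl, rfl⟩
  exact ⟨List.isChain_singleton _, rfl, rfl⟩

theorem not_isDirPath_nil {E : Fin d → Fin d → Prop} {u v : Fin d} : ¬ IsDirPath E u v [] :=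
  fun h => by simpa using h.2.1

theorem IsDirPath.reflTransGen {E : Fin d → Fin d → Prop} {u v : Fin d} {p : List (Fin d)}
    (h : IsDirPath E u v p) : Relation.ReflTransGen E u v := by
  induction p generalizing u with
  | nil => exact absurd h not_isDirPath_nil
  | cons a p ih =>
    cases p with
    | nil =>
      obtain ⟨rfl, rfl⟩ := isDirPath_singleton.1 h
      exact .refl
    | cons k p =>
      obtain ⟨-, huk, hk⟩ := isDirPath_cons_cons.1 h
      exact .head huk (ih hk)

/-- A directed path can be extended by an edge at its end. -/
theorem IsDirPath.concat {E : Fin d → Fin d → Prop} (c : Fin d → Fin d → ℝ≥0)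
    {u v w : Fin d} {p : List (Fin d)} (h : IsDirPath E u v p) (hvw : E v w) :
    IsDirPath E u w (p ++ [w]) ∧ pathWeight c (p ++ [w]) = c w v * pathWeight c p := by
  induction p generalizing u with
  | nil => exact absurd h not_isDirPath_nil
  | cons a p ih =>
    cases p with
    | nil =>
      obtain ⟨rfl, rfl⟩ := isDirPath_singleton.1 h
      exact ⟨isDirPath_cons_cons.2 ⟨rfl, hvw, isDirPath_singleton.2 ⟨rfl, rfl⟩⟩,
        by simp [pathWeight]⟩
    | cons k p =>
      obtain ⟨rfl, huk, hk⟩ := isDirPath_cons_cons.1 h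
      obtain ⟨h1, h2⟩ := ih hk
      simp only [List.cons_append] at h1 h2 ⊢
      refine ⟨isDirPath_cons_cons.2 ⟨rfl, huk, h1⟩, ?_⟩
      rw [pathWeight_cons_cons, h2, pathWeight_cons_cons, mul_left_comm]

/-- If `x` dominates its weighted parents along every edge, it does so along every path. -/
theorem IsDirPath.pathWeight_mul_le {E : Fin d → Fin d → Prop} {c : Fin d → Fin d → ℝ≥0}
    {x : Fin d → ℝ≥0} (hx : ∀ u v, E u v → c v u * x u ≤ x v)
    {u v : Fin d} {p : List (Fin d)} (h : IsDirPath E u v p) :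
    pathWeight c p * x u ≤ x v := by
  induction p generalizing u with
  | nil => exact absurd h not_isDirPath_nil
  | cons a p ih =>
    cases p with
    | nil =>
      obtain ⟨rfl, rfl⟩ := isDirPath_singleton.1 h
      simp [pathWeight]
    | cons k p =>
      obtain ⟨rfl, huk, hk⟩ := isDirPath_cons_cons.1 h
      calc pathWeight c (a :: k :: p) * x a = pathWeight c (k :: p) * (c k a * x a) := by
            rw [pathWeight_cons_cons]; ring
        _ ≤ pathWeight c (k :: p) * x k := by gcongr; exact hx _ _ huk
        _ ≤ x v := ih hk

/-- **Max-linear representation in terms of the noise variables.**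
If `x` solves the recursive max-linear structural equation system
`x v = (⋁_{u ∈ pa(v)} c v u * x u) ⊔ z v` on a well-ordered DAG with positive edge
weights and positive `z`, then `x v = ⋁_{u ∈ An(v)} b v u * z u`, where `b` is the
max-linear coefficient matrix and `An(v) = an(v) ∪ {v}` is the set of vertices with a
directed path to `v`. -/
theorem maxLinear_noise_representation
    (E : Fin d → Fin d → Prop) (hwo : ∀ u v, E u v → u < v)
    (c : Fin d → Fin d → ℝ≥0) (hc : ∀ u v, E u v → 0 < c v u)
    (z : Fin d → ℝ≥0) (hz : ∀ v, 0 < z v)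
    (b : Fin d → Fin d → ℝ≥0) (hb : IsMLCoeff E c b)
    (x : Fin d → ℝ≥0)
    (hx : ∀ v, x v = (Finset.univ.filter fun u => E u v).sup (fun u => c v u * x u) ⊔ z v) :
    ∀ v, x v =
      (Finset.univ.filter fun u => Relation.ReflTransGen E u v).sup
        (fun u => b v u * z u) := by
  have hedge : ∀ u v, E u v → c v u * x u ≤ x v := fun u v huv => by
    rw [hx v]
    exact le_sup_of_le_left
      (Finset.le_sup (f := fun u => c v u * x u) (by simpa using huv))
  have hzx : ∀ v, z v ≤ x v := fun v => by
    rw [hx v]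
    exact le_sup_right
  have hpath : ∀ v, ∃ u p, IsDirPath E u v p ∧ x v ≤ pathWeight c p * z u := by
    intro v
    induction v using WellFoundedLT.induction with
    | ind v ih =>
    by_contra! hlt
    have hpos : 0 < x v := (hz v).trans_le (hzx v)
    refine (lt_irrefl (x v)) ?_
    conv_lhs => rw [hx v]
    rw [max_lt_iff, Finset.sup_lt_iff (by simpa using hpos)]
    constructor
    · intro u hu
      have huv : E u v := by simpa using hu
      obtain ⟨w, p, hp, hle⟩ := ih u (hwo u v huv)
      obtain ⟨hp', hw⟩ := hp.concat c huv
      refine lt_of_le_of_lt ?_ (hlt w _ hp')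
      rw [hw, mul_assoc]
      gcongr
    · simpa [pathWeight] using hlt v [v] (isDirPath_singleton.2 ⟨rfl, rfl⟩)
  intro v
  apply le_antisymm
  · obtain ⟨u, p, hp, hle⟩ := hpath v
    calc x v ≤ pathWeight c p * z u := hle
      _ ≤ b v u * z u := by gcongr; exact (hb v u).1 p hp
      _ ≤ _ := Finset.le_sup (f := fun u => b v u * z u) (by simpa using hp.reflTransGen)
  · refine Finset.sup_le fun u _ => ?_
    by_cases h : ∃ p, IsDirPath E u v p
    · obtain ⟨p, hp, hw⟩ := (hb v u).2.1 h
      rw [← hw]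
      exact (by gcongr; exact hzx u : pathWeight c p * z u ≤ pathWeight c p * x u).trans
        (hp.pathWeight_mul_le hedge)
    · simp [(hb v u).2.2 h]

end MaxLinear9
end

section
/- Let Z_1, Z_2 be independent, identically distributed random variables with a continuous (atomless) distribution supported on (0, ∞), let c > 0, and set X_1 = Z_1 and X_2 = max(c X_1, Z_2). Then: (i) P(X_2 ≥ c X_1) = 1; (ii) P(X_2 = c X_1) > 0, i.e., the line {x_2 = c x_1} is an atom of the distribution of (X_1, X_2); and (iii) for every t ≠ c, P(X_2 / X_1 = t) = 0, so {c} is the only atom of the distribution of the ratio X_2 / X_1. -/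
open MeasureTheory ProbabilityTheory

/-- A random variable with an atomless law almost surely avoids any measurable function of an
independent random variable. -/
theorem ProbabilityTheory.IndepFun.measure_eq_comp_eq_zero
    {Ω α β : Type*} [MeasurableSpace Ω] [MeasurableSpace α] [MeasurableSpace β]
    [MeasurableEq β] {μ : Measure Ω} [IsFiniteMeasure μ]
    {X : Ω → α} {Y : Ω → β} (hX : Measurable X) (hY : Measurable Y)
    (hXY : IndepFun X Y μ) [NullSingletonClass (μ.map Y)] {g : α → β} (hg : Measurable g) :
    μ {ω | Y ω = g (X ω)} = 0 := by
  have hs : MeasurableSet {p : α × β | p.2 = g p.1} :=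
    measurableSet_eq_fun measurable_snd (hg.comp measurable_fst)
  have hmap := (indepFun_iff_map_prod_eq_prod_map_map hX.aemeasurable hY.aemeasurable).1 hXY
  have h : μ.map (fun ω => (X ω, Y ω)) {p : α × β | p.2 = g p.1} = 0 := by
    rw [hmap, Measure.measure_prod_null hs]
    exact Filter.Eventually.of_forall fun x => measure_singleton (g x)
  rwa [Measure.map_apply (hX.prodMk hY) hs] at h

/-- **The atom of the simple max-linear model `1 → 2` (Example "Estimation from the
atoms").**  Let `Z₁, Z₂` be i.i.d. with an atomless distribution supported on `(0, ∞)`,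
let `c > 0`, and set `X₁ = Z₁`, `X₂ = max (c X₁) Z₂`.  Then
(i) `X₂ ≥ c X₁` almost surely;
(ii) the line `{x₂ = c x₁}` is an atom: `P(X₂ = c X₁) > 0`; and
(iii) `{c}` is the only atom of the ratio `X₂ / X₁`: `P(X₂ / X₁ = t) = 0` for `t ≠ c`. -/
theorem simple_maxLinear_atom
    {Ω : Type*} [MeasurableSpace Ω] (μ : Measure Ω) [IsProbabilityMeasure μ]
    (Z₁ Z₂ : Ω → ℝ) (hZ₁m : Measurable Z₁) (hZ₂m : Measurable Z₂)
    (hindep : IndepFun Z₁ Z₂ μ)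
    (hid : μ.map Z₁ = μ.map Z₂)
    (hatomless : NoAtoms (μ.map Z₁))
    (hpos₁ : ∀ᵐ ω ∂μ, 0 < Z₁ ω) (hpos₂ : ∀ᵐ ω ∂μ, 0 < Z₂ ω)
    (hsupp : ∀ a b : ℝ, 0 ≤ a → a < b → 0 < μ {ω | Z₁ ω ∈ Set.Ioo a b})
    (c : ℝ) (hc : 0 < c)
    (X₁ X₂ : Ω → ℝ)
    (hX₁ : ∀ ω, X₁ ω = Z₁ ω)
    (hX₂ : ∀ ω, X₂ ω = max (c * X₁ ω) (Z₂ ω)) :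
    μ {ω | c * X₁ ω ≤ X₂ ω} = 1 ∧
    0 < μ {ω | X₂ ω = c * X₁ ω} ∧
    ∀ t : ℝ, t ≠ c → μ {ω | X₂ ω / X₁ ω = t} = 0 := by
  refine ⟨?_, ?_, fun t ht => ?_⟩
  · simp [hX₂]
  · have h₁ : μ (Z₁ ⁻¹' Set.Ioo 1 2) ≠ 0 := (hsupp 1 2 zero_le_one one_lt_two).ne'
    have h₂ : μ (Z₂ ⁻¹' Set.Ioo 0 c) ≠ 0 := by
      rw [← Measure.map_apply hZ₂m measurableSet_Ioo, ← hid,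
        Measure.map_apply hZ₁m measurableSet_Ioo]
      exact (hsupp 0 c le_rfl hc).ne'
    have h := hindep.measure_inter_preimage_eq_mul _ _
      (measurableSet_Ioo (a := (1 : ℝ)) (b := 2)) (measurableSet_Ioo (a := 0) (b := c))
    refine (pos_iff_ne_zero.2 (h ▸ mul_ne_zero h₁ h₂)).trans_le (measure_mono ?_)
    rintro ω ⟨⟨hω₁, -⟩, -, hω₂⟩
    rw [Set.mem_ofPred_eq, hX₂, hX₁]
    exact max_eq_left (by nlinarith)
  · have : NullSingletonClass (μ.map Z₂) := hid ▸ hatomless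
    have h := hindep.measure_eq_comp_eq_zero hZ₁m hZ₂m (measurable_const_mul t)
    refine measure_mono_null_ae ?_ h
    filter_upwards [hpos₁] with ω hω hratio
    have hX : max (c * Z₁ ω) (Z₂ ω) = t * Z₁ ω := by
      rw [← hX₁, ← hX₂]
      exact (div_eq_iff (by rw [hX₁]; exact hω.ne')).1 hratio
    rcases max_choice (c * Z₁ ω) (Z₂ ω) with hmax | hmax
    · exact absurd (mul_right_cancel₀ hω.ne' (hX.symm.trans hmax)) ht
    · exact hmax.symm.trans hX
end
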